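/- arXiv:1008.1037 — 5 statements merged into one kernel-verified Lean document; each statement's English description precedes it below -/
import Mathlib

section
/- Each orbit of a quasiparabolic W-set contains at most one W-minimal element: if x ∈ X and w ∈ W are such that both x and w·x are W-minimal, then w·x = x. -/
open CoxeterSystem

variable {B W : Type*} [Group W] {M : CoxeterMatrix B}

/-- A scaled `W`-set: heights change by at most 1 under simple reflections. -/
def IsScaled (cs : CoxeterSystem M W) {X : Type*} [MulAction W X] (hgt : X → ℤ) : Prop :=
  ∀ (b : B) (x : X), |hgt (cs.simple b • x) - hgt x| ≤ 1

/-- A quasiparabolic `W`-set: scaled, plus (QP1) and (QP2). -/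
def IsQuasiparabolic (cs : CoxeterSystem M W) {X : Type*} [MulAction W X] (hgt : X → ℤ) : Prop :=
  IsScaled cs hgt ∧
  (∀ (r : W) (x : X), cs.IsReflection r → hgt (r • x) = hgt x → r • x = x) ∧
  (∀ (r : W) (b : B) (x : X), cs.IsReflection r → hgt x < hgt (r • x) →
    hgt (cs.simple b • r • x) < hgt (cs.simple b • x) → r • x = cs.simple b • x)

/-- Strong exchange for quasiparabolic sets: if the reflection `r` raises `x`, then a word `ω` either
preserves the strict inequality, or its value at `r • x` is that of a shorter word at `x`. -/
theorem IsQuasiparabolic.strong_exchange {cs : CoxeterSystem M W} {X : Type*} [MulAction W X]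
    {hgt : X → ℤ} (hqp : IsQuasiparabolic cs hgt) {r : W} (hr : cs.IsReflection r) {x : X}
    (hx : hgt x < hgt (r • x)) (ω : List B) :
    hgt (cs.wordProd ω • x) < hgt (cs.wordProd ω • r • x) ∨
      ∃ ω' : List B, ω'.length < ω.length ∧
        cs.wordProd ω • r • x = cs.wordProd ω' • x := by
  obtain ⟨-, qp1, qp2⟩ := hqp
  induction ω with
  | nil => left; simpa using hx
  | cons i ω ih =>
    rcases ih with h | ⟨ω', hlen, h⟩
    · have hconj : (cs.wordProd ω * r * (cs.wordProd ω)⁻¹) • cs.wordProd ω • x =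
          cs.wordProd ω • r • x := by
        simp [mul_smul]
      have hrefl := hr.conj (cs.wordProd ω)
      simp only [cs.wordProd_cons, mul_smul]
      rcases lt_trichotomy (hgt (cs.simple i • cs.wordProd ω • x))
        (hgt (cs.simple i • cs.wordProd ω • r • x)) with hlt | heq | hgt'
      · exact Or.inl hlt
      · have hconj' : (cs.simple i * (cs.wordProd ω * r * (cs.wordProd ω)⁻¹) * (cs.simple i)⁻¹) •
            cs.simple i • cs.wordProd ω • x = cs.simple i • cs.wordProd ω • r • x := by
          simp only [mul_smul, inv_smul_smul]
        have hfix := qp1 _ _ (hrefl.conj (cs.simple i)) (by rw [hconj', heq])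
        rw [hconj'] at hfix
        rw [smul_left_cancel _ hfix] at h
        exact absurd h (lt_irrefl _)
      · refine Or.inr ⟨ω, by simp, ?_⟩
        have hswap := qp2 _ i (cs.wordProd ω • x) hrefl (by rwa [hconj]) (by rwa [hconj])
        rw [← hconj, hswap, ← mul_smul, cs.simple_mul_simple_self, one_smul]
    · refine Or.inr ⟨i :: ω', by simpa using hlen, ?_⟩
      simp only [cs.wordProd_cons, mul_smul, h]

/-- A `W`-minimal element is the only element of its orbit of height at most its own. -/
theorem IsQuasiparabolic.smul_eq_of_hgt_le {cs : CoxeterSystem M W} {X : Type*} [MulAction W X]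
    {hgt : X → ℤ} (hqp : IsQuasiparabolic cs hgt) {x : X}
    (hmin : ∀ b : B, hgt x ≤ hgt (cs.simple b • x)) {w : W} (hw : hgt (w • x) ≤ hgt x) :
    w • x = x := by
  obtain ⟨ω, rfl⟩ := cs.wordProd_surjective w
  induction hn : ω.length using Nat.strong_induction_on generalizing ω with
  | _ n ih =>
    subst hn
    rcases List.eq_nil_or_concat' ω with rfl | ⟨ω, i, rfl⟩
    · simp
    have hprod : cs.wordProd (ω ++ [i]) • x = cs.wordProd ω • cs.simple i • x := by
      simp [cs.wordProd_append, mul_smul]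
    have hlen : ω.length < (ω ++ [i]).length := by simp
    rw [hprod] at hw ⊢
    rcases (hmin i).eq_or_lt with heq | hlt
    · have hfix := hqp.2.1 _ x (cs.isReflection_simple i) heq.symm
      rw [hfix] at hw ⊢
      exact ih _ hlen ω hw rfl
    · rcases hqp.strong_exchange (cs.isReflection_simple i) hlt ω with h | ⟨ω', hlen', h⟩
      · have hfix := ih _ hlen ω (h.le.trans hw) rfl
        rw [hfix] at h
        exact absurd (h.trans_le hw) (lt_irrefl _)
      · rw [h] at hw ⊢
        exact ih _ (hlen'.trans hlen) ω' hw rfl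

/-- each orbit of a quasiparabolic `W`-set contains at most one
`W`-minimal element. -/
theorem minimal_unique_in_orbit (cs : CoxeterSystem M W) {X : Type*} [MulAction W X]
    (hgt : X → ℤ) (hqp : IsQuasiparabolic cs hgt) (x : X) (w : W)
    (hminx : ∀ b : B, hgt x ≤ hgt (cs.simple b • x))
    (hminwx : ∀ b : B, hgt (w • x) ≤ hgt (cs.simple b • w • x)) :
    w • x = x := by
  rcases le_total (hgt (w • x)) (hgt x) with h | h
  · exact hqp.smul_eq_of_hgt_le hminx h
  · have hinv := hqp.smul_eq_of_hgt_le hminwx (w := w⁻¹) (by simpa using h)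
    simpa using hinv.symm
end

section
/- If H ⊆ W is a quasiparabolic subgroup, then so is its even subgroup H ∩ W⁰, where W⁰ = {w ∈ W : ℓ(w) is even}. -/
open CoxeterSystem

variable {B W : Type*} [Group W] {M : CoxeterMatrix B}

/-- Height of a coset: the minimal length of a representative (as a natural number). -/
noncomputable def cosetHeightN (cs : CoxeterSystem M W) (H : Subgroup W) (x : W ⧸ H) : ℕ :=
  sInf {n : ℕ | ∃ v : W, (v : W ⧸ H) = x ∧ cs.length v = n}

/-- Height of a coset: the minimal length of a representative. -/
noncomputable def cosetHeight (cs : CoxeterSystem M W) (H : Subgroup W) (x : W ⧸ H) : ℤ :=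
  (cosetHeightN cs H x : ℤ)

/-- A quasiparabolic subgroup: one for which `W ⧸ H` with the minimal-length height
function is a quasiparabolic `W`-set. -/
def IsQuasiparabolicSubgroup (cs : CoxeterSystem M W) (H : Subgroup W) : Prop :=
  IsQuasiparabolic cs (cosetHeight cs H)

/-- The even subgroup `W⁰ = {w : ℓ(w) even}` of a Coxeter group. -/
def evenSubgroup (cs : CoxeterSystem M W) : Subgroup W where
  carrier := {w | Even (cs.length w)}
  one_mem' := by simp [Set.mem_setOf_eq]
  mul_mem' := by
    intro a b ha hb
    simp only [Set.mem_setOf_eq, Nat.even_iff] at *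
    have := cs.length_mul_mod_two a b
    omega
  inv_mem' := by
    intro a ha
    simpa only [Set.mem_setOf_eq, cs.length_inv] using ha

namespace CoxeterSystem

/-- Odd elements of the dihedral subgroup generated by two simple reflections are reflections. -/
theorem isReflection_zpow_mul_simple (cs : CoxeterSystem M W) (s a : B) (k : ℤ) :
    cs.IsReflection ((cs.simple s * cs.simple a) ^ k * cs.simple s) := by
  set p := cs.simple s * cs.simple a with hp
  have hinv (j : ℤ) : p ^ j * cs.simple s = cs.simple s * (p ^ j)⁻¹ := by
    have h1 : SemiconjBy (cs.simple s) p⁻¹ p := by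
      simp [SemiconjBy, hp, mul_assoc]
    have h2 := h1.zpow_right j
    rw [inv_zpow] at h2
    exact h2.eq.symm
  obtain ⟨j, rfl | rfl⟩ := Int.even_or_odd' k
  · refine ⟨p ^ j, s, ?_⟩
    rw [mul_assoc, ← hinv, ← mul_assoc, ← zpow_add]
    congr 2
    ring
  · have h : p ^ (2 * j + 1) * cs.simple s = (p ^ j * cs.simple s) * cs.simple a *
        (p ^ j * cs.simple s)⁻¹ := by
      rw [mul_inv_rev, cs.inv_simple, mul_assoc (p ^ j * _), mul_assoc (p ^ j),
        ← hinv, ← mul_assoc, ← mul_assoc, ← mul_assoc, mul_assoc (p ^ j), ← hp]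
      congr 1
      rw [← zpow_add_one, ← zpow_add]
      congr 1
      ring
    exact ⟨_, _, h⟩

end CoxeterSystem

section QuasiparabolicSet

variable {X : Type*} [MulAction W X] {hgt : X → ℤ}

theorem IsQuasiparabolic.exists_simple_smul_eq_of_dihedral {cs : CoxeterSystem M W}
    (h : IsQuasiparabolic cs hgt) (hpos : ∀ x, 0 ≤ hgt x) (n : ℕ) :
    ∀ (s a : B) (k : ℤ) (z : X), hgt z ≤ n →
      ((cs.simple s * cs.simple a) ^ k * cs.simple s) • z = z →
      hgt (cs.simple a • z) < hgt z → ∃ (b : B) (y : X), cs.simple b • y = y ∧ hgt y < hgt z := by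
  obtain ⟨hsc, hqp1, -⟩ := h
  induction n with
  | zero =>
    intro s a k z hz _ hlt
    have := hpos (cs.simple a • z)
    simp only [Nat.cast_zero] at hz
    omega
  | succ n ih =>
    intro s a k z hz hfix hlt
    have haz := abs_le.1 (hsc a z)
    have hsaz := abs_le.1 (hsc s (cs.simple a • z))
    rcases lt_trichotomy (hgt (cs.simple s • cs.simple a • z)) (hgt (cs.simple a • z)) with
      hc | hc | hc
    · obtain ⟨b, y, hy, hlt'⟩ := ih a s (k + 1) (cs.simple a • z) (by push_cast at hz; omega)
        (by
          have hconj : (cs.simple a * cs.simple s) ^ (k + 1) * cs.simple a * cs.simple a =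
              cs.simple a * ((cs.simple s * cs.simple a) ^ k * cs.simple s) := by
            have hsemi : SemiconjBy (cs.simple a) (cs.simple s * cs.simple a)
                (cs.simple a * cs.simple s) := by simp [SemiconjBy, mul_assoc]
            rw [← mul_assoc, (hsemi.zpow_right k).eq, zpow_add_one]
            simp [mul_assoc]
          rw [smul_smul, hconj, mul_smul, hfix]) hc
      exact ⟨b, y, hy, by omega⟩
    · exact ⟨s, _, hqp1 _ _ (cs.isReflection_simple s) hc, hlt⟩
    · exfalso
      set p := cs.simple s * cs.simple a with hp
      have hpz : p • z = z := by
        have h1 : (p ^ (k + 1) * cs.simple s) • z = p • z := by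
          rw [add_comm, zpow_one_add, mul_assoc, mul_smul, hfix]
        rw [← h1]
        apply hqp1 _ _ (cs.isReflection_zpow_mul_simple s a (k + 1))
        rw [h1, hp, mul_smul]
        omega
      have hsz : cs.simple s • z = cs.simple a • z := by
        conv_lhs => rw [← hpz, hp, mul_smul, smul_smul, cs.simple_mul_simple_self, one_smul]
      have hpk : p ^ (-k) • z = z :=
        (MulAction.stabilizer W z).zpow_mem (MulAction.mem_stabilizer_iff.2 hpz) (-k)
      have : cs.simple s • z = z := by
        rw [mul_smul] at hfix
        rw [smul_eq_iff_eq_inv_smul, ← zpow_neg, hpk] at hfix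
        exact hfix
      rw [hsz] at this
      rw [this] at hlt
      exact lt_irrefl _ hlt

/-- If no simple reflection has a fixed point, height parity tracks length parity. -/
theorem IsQuasiparabolic.two_dvd_hgt_smul_sub {cs : CoxeterSystem M W}
    (h : IsQuasiparabolic cs hgt) (hfree : ∀ (b : B) (y : X), cs.simple b • y ≠ y)
    (w : W) (x : X) : (2 : ℤ) ∣ hgt (w • x) - hgt x - cs.length w := by
  induction w using cs.simple_induction_left with
  | one => simp
  | mul_simple_left w b ih =>
    have h1 := abs_le.1 (h.1 b (w • x))
    have h2 : hgt (cs.simple b • w • x) ≠ hgt (w • x) := fun he =>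
      hfree b _ (h.2.1 _ _ (cs.isReflection_simple b) he)
    have h3 := cs.length_simple_mul w b
    rw [mul_smul]
    omega

end QuasiparabolicSet

theorem cosetHeightN_le (cs : CoxeterSystem M W) (H : Subgroup W) (v : W) :
    cosetHeightN cs H (v : W ⧸ H) ≤ cs.length v :=
  Nat.sInf_le ⟨v, rfl, rfl⟩

theorem exists_length_eq_cosetHeightN (cs : CoxeterSystem M W) (H : Subgroup W) (x : W ⧸ H) :
    ∃ v : W, (v : W ⧸ H) = x ∧ cs.length v = cosetHeightN cs H x := by
  obtain ⟨w, rfl⟩ := QuotientGroup.mk_surjective x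
  exact Nat.sInf_mem (s := {n : ℕ | ∃ v : W, (v : W ⧸ H) = (w : W ⧸ H) ∧ cs.length v = n})
    ⟨_, w, rfl, rfl⟩

theorem IsQuasiparabolicSubgroup.exists_simple_mem_of_smul_eq {cs : CoxeterSystem M W}
    {H : Subgroup W} (hqp : IsQuasiparabolicSubgroup cs H) (n : ℕ) :
    ∀ (b : B) (y : W ⧸ H), cosetHeightN cs H y ≤ n → cs.simple b • y = y →
      ∃ s : B, cs.simple s ∈ H := by
  induction n with
  | zero =>
    intro b y hy hfix
    obtain ⟨v, rfl, hv⟩ := exists_length_eq_cosetHeightN cs H y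
    obtain rfl : v = 1 := cs.length_eq_zero_iff.1 (by omega)
    refine ⟨b, ?_⟩
    have := QuotientGroup.eq.1 hfix.symm
    simpa using this
  | succ n ih =>
    intro b y hy hfix
    by_cases hn : cosetHeightN cs H y ≤ n
    · exact ih b y hn hfix
    obtain ⟨v, rfl, hv⟩ := exists_length_eq_cosetHeightN cs H y
    have hv1 : v ≠ 1 := by
      rintro rfl
      simp at hv
      omega
    obtain ⟨a, ha⟩ := cs.exists_leftDescent_of_ne_one hv1
    have hlt : cosetHeight cs H (cs.simple a • (v : W ⧸ H)) < cosetHeight cs H (v : W ⧸ H) := by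
      have := cosetHeightN_le cs H (cs.simple a * v)
      unfold CoxeterSystem.IsLeftDescent at ha
      simp only [cosetHeight, MulAction.Quotient.smul_coe, smul_eq_mul]
      omega
    obtain ⟨c, z, hz, hzlt⟩ := IsQuasiparabolic.exists_simple_smul_eq_of_dihedral hqp
      (fun x => Int.natCast_nonneg _) (cosetHeightN cs H (v : W ⧸ H)) b a 0 v le_rfl
      (by simpa using hfix) hlt
    simp only [cosetHeight] at hzlt
    exact ih c z (by omega) hz

/-- A quasiparabolic subgroup containing an odd element contains a simple reflection. -/
theorem IsQuasiparabolicSubgroup.exists_simple_mem {cs : CoxeterSystem M W}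
    {H : Subgroup W} (hqp : IsQuasiparabolicSubgroup cs H) (hodd : ¬ H ≤ evenSubgroup cs) :
    ∃ s : B, cs.simple s ∈ H := by
  by_contra hno
  obtain ⟨h, hH, he⟩ := SetLike.not_le_iff_exists.1 hodd
  have hdvd := IsQuasiparabolic.two_dvd_hgt_smul_sub hqp
    (fun b y hy => hno (hqp.exists_simple_mem_of_smul_eq _ b y le_rfl hy)) h ((1 : W) : W ⧸ H)
  have hfix : h • ((1 : W) : W ⧸ H) = ((1 : W) : W ⧸ H) := by
    rw [MulAction.Quotient.smul_coe, eq_comm, QuotientGroup.eq]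
    simpa using hH
  rw [hfix] at hdvd
  refine he (even_iff_two_dvd.2 ?_)
  omega

theorem mem_evenSubgroup_inv_mul_iff (cs : CoxeterSystem M W) (v w : W) :
    v⁻¹ * w ∈ evenSubgroup cs ↔ cs.length v % 2 = cs.length w % 2 := by
  change Even (cs.length (v⁻¹ * w)) ↔ _
  have := cs.length_mul_mod_two v⁻¹ w
  rw [cs.length_inv] at this
  rw [Nat.even_iff]
  omega

theorem mk_inf_evenSubgroup_eq_iff (cs : CoxeterSystem M W) (H : Subgroup W) (v w : W) :
    (v : W ⧸ H ⊓ evenSubgroup cs) = w ↔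
      (v : W ⧸ H) = w ∧ cs.length v % 2 = cs.length w % 2 := by
  rw [QuotientGroup.eq, QuotientGroup.eq, Subgroup.mem_inf, mem_evenSubgroup_inv_mul_iff]

/-- The height on cosets of the even subgroup differs from the height on cosets of `H` by the
parity defect, as soon as `H` contains a simple reflection. -/
theorem cosetHeightN_inf_evenSubgroup (cs : CoxeterSystem M W) {H : Subgroup W} {s : B}
    (hs : cs.simple s ∈ H) (w : W) :
    cosetHeightN cs (H ⊓ evenSubgroup cs) (w : W ⧸ H ⊓ evenSubgroup cs) % 2 =
        cs.length w % 2 ∧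
      cosetHeightN cs H (w : W ⧸ H) ≤
        cosetHeightN cs (H ⊓ evenSubgroup cs) (w : W ⧸ H ⊓ evenSubgroup cs) ∧
      cosetHeightN cs (H ⊓ evenSubgroup cs) (w : W ⧸ H ⊓ evenSubgroup cs) ≤
        cosetHeightN cs H (w : W ⧸ H) + 1 := by
  obtain ⟨u, hu, hul⟩ := exists_length_eq_cosetHeightN cs (H ⊓ evenSubgroup cs)
    (w : W ⧸ H ⊓ evenSubgroup cs)
  obtain ⟨huH, hup⟩ := (mk_inf_evenSubgroup_eq_iff cs H u w).1 hu
  have hle := cosetHeightN_le cs H u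
  rw [huH] at hle
  refine ⟨by omega, by omega, ?_⟩
  obtain ⟨v, hv, hvl⟩ := exists_length_eq_cosetHeightN cs H (w : W ⧸ H)
  have hvs : ((v * cs.simple s : W) : W ⧸ H) = w := by
    rw [← hv, eq_comm, QuotientGroup.eq]
    simpa using hs
  have hlen := cs.length_mul_simple v s
  by_cases hpar : cs.length v % 2 = cs.length w % 2
  · have := cosetHeightN_le cs (H ⊓ evenSubgroup cs) v
    rw [(mk_inf_evenSubgroup_eq_iff cs H v w).2 ⟨hv, hpar⟩] at this
    omega
  · have := cosetHeightN_le cs (H ⊓ evenSubgroup cs) (v * cs.simple s)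
    rw [(mk_inf_evenSubgroup_eq_iff cs H (v * cs.simple s) w).2 ⟨hvs, by omega⟩] at this
    omega

/-- if `H` is a quasiparabolic subgroup of `W`, then so is its even
subgroup `H ∩ W⁰`. -/
theorem even_subgroup_quasiparabolic (cs : CoxeterSystem M W) (H : Subgroup W)
    (hqp : IsQuasiparabolicSubgroup cs H) :
    IsQuasiparabolicSubgroup cs (H ⊓ evenSubgroup cs) := by
  by_cases heven : H ≤ evenSubgroup cs
  · rwa [inf_eq_left.2 heven]
  obtain ⟨s, hs⟩ := hqp.exists_simple_mem heven
  have key := cosetHeightN_inf_evenSubgroup cs hs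
  obtain ⟨hsc, hqp1, hqp2⟩ := hqp
  have hscaled : IsScaled cs (cosetHeight cs (H ⊓ evenSubgroup cs)) := by
    intro b x
    obtain ⟨w, rfl⟩ := QuotientGroup.mk_surjective x
    have h1 := abs_le.1 (hsc b (w : W ⧸ H))
    have h2 := key w
    have h3 := key (cs.simple b * w)
    have h4 := cs.length_simple_mul w b
    rw [abs_le]
    simp only [cosetHeight, MulAction.Quotient.smul_coe, smul_eq_mul] at h1 ⊢
    omega
  refine ⟨hscaled, ?_, ?_⟩
  · intro r x hr hx
    exfalso
    obtain ⟨w, rfl⟩ := QuotientGroup.mk_surjective x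
    have h2 := key w
    have h3 := key (r * w)
    have h4 := cs.length_mul_mod_two r w
    have h5 := Nat.odd_iff.1 hr.odd_length
    simp only [cosetHeight, MulAction.Quotient.smul_coe, smul_eq_mul] at hx
    omega
  · intro r b x hr hlt hlt'
    obtain ⟨w, rfl⟩ := QuotientGroup.mk_surjective x
    have hb1 := abs_le.1 (hscaled b (w : W ⧸ H ⊓ evenSubgroup cs))
    have hb2 := abs_le.1 (hscaled b (r • (w : W ⧸ H ⊓ evenSubgroup cs)))
    have k1 := key w
    have k2 := key (r * w)
    have k3 := key (cs.simple b * w)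
    have k4 := key (cs.simple b * (r * w))
    have h4 := cs.length_mul_mod_two r w
    have h5 := Nat.odd_iff.1 hr.odd_length
    have h6 := cs.length_simple_mul w b
    have h7 := cs.length_simple_mul (r * w) b
    have q1 := hqp1 r (w : W ⧸ H) hr
    have q2 := hqp1 (cs.simple b) (w : W ⧸ H) (cs.isReflection_simple b)
    have q3 := hqp2 r b (w : W ⧸ H) hr
    have q4 := hqp1 (cs.simple b * r * (cs.simple b)⁻¹) (cs.simple b • (w : W ⧸ H))
      (hr.conj (cs.simple b))
    rw [show (cs.simple b * r * (cs.simple b)⁻¹) • cs.simple b • (w : W ⧸ H) =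
      cs.simple b • r • (w : W ⧸ H) by simp [mul_assoc]] at q4
    simp only [cosetHeight, MulAction.Quotient.smul_coe, smul_eq_mul] at *
    rw [mk_inf_evenSubgroup_eq_iff]
    refine ⟨?_, by omega⟩
    have fixed (hrw : ((r * w : W) : W ⧸ H) = w) :
        ((r * w : W) : W ⧸ H) = ((cs.simple b * w : W) : W ⧸ H) := by
      have hbrw : ((cs.simple b * (r * w) : W) : W ⧸ H) = ((cs.simple b * w : W) : W ⧸ H) :=
        congrArg (cs.simple b • ·) hrw
      rw [hrw] at k2
      rw [hbrw] at k4
      rw [hrw, q2 (by omega)]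
    by_cases e1 : cosetHeightN cs H ((r * w : W) : W ⧸ H) = cosetHeightN cs H (w : W ⧸ H)
    · exact fixed (q1 (by omega))
    by_cases e2 : cosetHeightN cs H ((cs.simple b * (r * w) : W) : W ⧸ H) =
        cosetHeightN cs H ((cs.simple b * w : W) : W ⧸ H)
    · exact fixed (MulAction.injective (cs.simple b) (q4 (by omega)))
    exact q3 (by omega) (by omega)
end

section
/- Let ι ∈ W be a perfect involution and r ∈ R(W). If ℓ(rιr) = ℓ(ι), then rιr = ι. (This is property QP1 for the conjugation action of W on its set of perfect involutions with height function ℓ(ι)/2.) -/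
open CoxeterSystem

variable {B W : Type*} [Group W] {M : CoxeterMatrix B}

/-- A perfect involution: an involution `ι` such that every reflection `r`
commutes with `ι r ι`. -/
def IsPerfectInvolution (cs : CoxeterSystem M W) (ι : W) : Prop :=
  ι * ι = 1 ∧ ∀ r : W, cs.IsReflection r → Commute r (ι * r * ι)

namespace CoxeterSystem

open scoped Classical in
/-- The permutation `(t, ε) ↦ (s t s, ε + [t = s])` of `W × ZMod 2` attached to a simple
reflection `s`. -/
noncomputable def simpleSignedConj (cs : CoxeterSystem M W) (i : B) :
    Equiv.Perm (W × ZMod 2) :=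
  Function.Involutive.toPerm
    (fun p ↦ (cs.simple i * p.1 * cs.simple i, p.2 + if p.1 = cs.simple i then 1 else 0)) (by
      rintro ⟨t, ε⟩
      have h : cs.simple i * t * cs.simple i = cs.simple i ↔ t = cs.simple i := by
        constructor
        · intro h
          have := congrArg (fun x ↦ cs.simple i * x * cs.simple i) h
          simpa [mul_assoc] using this
        · rintro rfl
          simp
      ext
      · simp [mul_assoc]
      · simp only [h, add_assoc, CharTwo.add_self_eq_zero, add_zero])

open scoped Classical in
theorem simpleSignedConj_apply (cs : CoxeterSystem M W) (i : B) (p : W × ZMod 2) :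
    cs.simpleSignedConj i p =
      (cs.simple i * p.1 * cs.simple i, p.2 + if p.1 = cs.simple i then 1 else 0) := rfl

open scoped Classical in
theorem simpleSignedConj_mul_pow_apply (cs : CoxeterSystem M W) (i j : B) (k : ℕ)
    (p : W × ZMod 2) :
    ((cs.simpleSignedConj i * cs.simpleSignedConj j) ^ k) p =
      ((cs.simple i * cs.simple j) ^ k * p.1 * ((cs.simple i * cs.simple j) ^ k)⁻¹,
        p.2 + ∑ n ∈ Finset.range (2 * k),
          if p.1 = ((cs.simple i * cs.simple j) ^ n)⁻¹ * cs.simple j then 1 else 0) := by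
  set ρ := cs.simple i * cs.simple j with hρ
  have hconj : ∀ l : ℕ, cs.simple j * ρ ^ l = (ρ ^ l)⁻¹ * cs.simple j := by
    intro l
    have h : cs.simple j * ρ * (cs.simple j)⁻¹ = ρ⁻¹ := by simp [hρ, mul_assoc]
    have h' := conj_pow (i := l) (a := cs.simple j) (b := ρ)
    rw [h, inv_pow] at h'
    rw [h']
    simp [mul_assoc]
  induction k with
  | zero => simp
  | succ k ih =>
    rw [pow_succ', Equiv.Perm.mul_apply, ih, Equiv.Perm.mul_apply, simpleSignedConj_apply,
      simpleSignedConj_apply]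
    have h₁ : ρ ^ k * p.1 * (ρ ^ k)⁻¹ = cs.simple j ↔ p.1 = (ρ ^ (2 * k))⁻¹ * cs.simple j := by
      rw [mul_inv_eq_iff_eq_mul, hconj, ← eq_inv_mul_iff_mul_eq, ← mul_assoc, two_mul, pow_add,
        mul_inv_rev]
    have h₂ : cs.simple j * (ρ ^ k * p.1 * (ρ ^ k)⁻¹) * cs.simple j = cs.simple i ↔
        p.1 = (ρ ^ (2 * k + 1))⁻¹ * cs.simple j := by
      have hs : cs.simple j * (ρ ^ k * p.1 * (ρ ^ k)⁻¹) * cs.simple j = cs.simple i ↔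
          ρ ^ k * p.1 * (ρ ^ k)⁻¹ = ρ⁻¹ * cs.simple j := by
        rw [← eq_mul_inv_iff_mul_eq, ← eq_inv_mul_iff_mul_eq]
        simp [hρ, mul_assoc]
      rw [hs, mul_inv_eq_iff_eq_mul, mul_assoc, hconj, ← eq_inv_mul_iff_mul_eq]
      have : (ρ ^ (2 * k + 1))⁻¹ = (ρ ^ k)⁻¹ * (ρ⁻¹ * (ρ ^ k)⁻¹) := by
        rw [show 2 * k + 1 = k + 1 + k by ring, pow_add, pow_succ, mul_inv_rev, mul_inv_rev]
      rw [this]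
      simp only [mul_assoc]
    ext
    · simp [hρ, pow_succ', mul_assoc]
    · simp only [h₁, h₂]
      rw [show 2 * (k + 1) = 2 * k + 1 + 1 by ring, Finset.sum_range_succ, Finset.sum_range_succ]
      simp only [add_assoc]

theorem isLiftable_simpleSignedConj (cs : CoxeterSystem M W) :
    M.IsLiftable cs.simpleSignedConj := by
  classical
  intro i j
  ext1 p
  rw [simpleSignedConj_mul_pow_apply, two_mul, Finset.sum_range_add]
  simp [pow_add, CharTwo.add_self_eq_zero]

/-- The action of `W` on `W × ZMod 2` extending `simpleSignedConj`. -/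
noncomputable def signedConj (cs : CoxeterSystem M W) : W →* Equiv.Perm (W × ZMod 2) :=
  cs.lift ⟨cs.simpleSignedConj, cs.isLiftable_simpleSignedConj⟩

theorem signedConj_simple (cs : CoxeterSystem M W) (i : B) :
    cs.signedConj (cs.simple i) = cs.simpleSignedConj i :=
  cs.lift_apply_simple cs.isLiftable_simpleSignedConj i

/-- The reflection cocycle: for a reflection `t`, it is `1` exactly when `t` is a right
inversion of `w`. -/
noncomputable def inversionCocycle (cs : CoxeterSystem M W) (w t : W) : ZMod 2 :=
  (cs.signedConj w (t, 0)).2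

theorem signedConj_apply (cs : CoxeterSystem M W) (w : W) (p : W × ZMod 2) :
    cs.signedConj w p = (w * p.1 * w⁻¹, p.2 + cs.inversionCocycle w p.1) := by
  induction w using cs.simple_induction_left generalizing p with
  | one => simp [inversionCocycle]
  | mul_simple_left w i ih =>
    rw [inversionCocycle]
    simp only [map_mul, Equiv.Perm.mul_apply, signedConj_simple, ih, simpleSignedConj_apply]
    simp [mul_assoc, add_assoc]

theorem inversionCocycle_mul (cs : CoxeterSystem M W) (u v t : W) :
    cs.inversionCocycle (u * v) t =
      cs.inversionCocycle v t + cs.inversionCocycle u (v * t * v⁻¹) := by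
  rw [inversionCocycle, map_mul, Equiv.Perm.mul_apply, signedConj_apply, signedConj_apply]
  simp

theorem inversionCocycle_one (cs : CoxeterSystem M W) (t : W) :
    cs.inversionCocycle 1 t = 0 := by
  simp [inversionCocycle]

open scoped Classical in
theorem inversionCocycle_simple (cs : CoxeterSystem M W) (i : B) (t : W) :
    cs.inversionCocycle (cs.simple i) t = if t = cs.simple i then 1 else 0 := by
  rw [inversionCocycle, signedConj_simple, simpleSignedConj_apply, zero_add]

theorem inversionCocycle_inv (cs : CoxeterSystem M W) (w t : W) :
    cs.inversionCocycle w⁻¹ t = cs.inversionCocycle w (w⁻¹ * t * w) := by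
  have h := cs.inversionCocycle_mul w w⁻¹ t
  rw [mul_inv_cancel, inversionCocycle_one, inv_inv] at h
  exact CharTwo.add_eq_zero.mp h.symm

theorem IsReflection.inversionCocycle_self {cs : CoxeterSystem M W} {t : W}
    (ht : cs.IsReflection t) : cs.inversionCocycle t t = 1 := by
  classical
  obtain ⟨u, i, rfl⟩ := ht
  simp only [inversionCocycle_mul, inversionCocycle_inv, inversionCocycle_simple]
  simp only [mul_assoc, inv_inv, inv_mul_cancel, mul_one, inv_mul_cancel_left, if_true,
    inv_simple, simple_mul_simple_self]
  rw [one_mul, add_left_comm, CharTwo.add_self_eq_zero, add_zero]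

theorem IsReflection.inversionCocycle_eq_zero_of_commute {cs : CoxeterSystem M W} {t r : W}
    (ht : cs.IsReflection t) (h : Commute r t) (hne : r ≠ t) : cs.inversionCocycle t r = 0 := by
  classical
  obtain ⟨u, i, rfl⟩ := ht
  have hs : u⁻¹ * r * u ≠ cs.simple i := by
    rintro heq
    exact hne (by rw [← heq]; group)
  have hconj : cs.simple i * (u⁻¹ * r * u) * cs.simple i = u⁻¹ * r * u := by
    have h' := congrArg (fun x ↦ u⁻¹ * x * u * cs.simple i) h.eq
    simpa [mul_assoc] using h'.symm
  rw [inversionCocycle_mul, inversionCocycle_mul, inversionCocycle_inv, inversionCocycle_simple,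
    inv_inv, if_neg hs, inv_simple, hconj, zero_add, CharTwo.add_self_eq_zero]

theorem mem_rightInvSeq_of_inversionCocycle_ne_zero (cs : CoxeterSystem M W) (ω : List B) {t : W}
    (h : cs.inversionCocycle (cs.wordProd ω) t ≠ 0) : t ∈ cs.rightInvSeq ω := by
  classical
  induction ω with
  | nil => simp [inversionCocycle_one] at h
  | cons i ω ih =>
    rw [wordProd_cons, inversionCocycle_mul, inversionCocycle_simple] at h
    rw [rightInvSeq, List.mem_cons]
    split_ifs at h with heq
    · left
      rw [← heq]
      group
    · exact Or.inr (ih (by simpa using h))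

/-- The strong exchange condition, in terms of the reflection cocycle. -/
theorem IsReflection.length_mul_lt_iff {cs : CoxeterSystem M W} {t : W} (ht : cs.IsReflection t)
    (w : W) : cs.length (w * t) < cs.length w ↔ cs.inversionCocycle w t ≠ 0 := by
  have key : ∀ v, cs.inversionCocycle v t ≠ 0 → cs.length (v * t) < cs.length v := by
    intro v hv
    obtain ⟨ω, hω, rfl⟩ := cs.exists_isReduced v
    exact (cs.isRightInversion_of_mem_rightInvSeq hω
      (cs.mem_rightInvSeq_of_inversionCocycle_ne_zero ω hv)).2
  refine ⟨fun hlt h0 ↦ ?_, key w⟩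
  have h := key (w * t) (by
    rw [inversionCocycle_mul, ht.inversionCocycle_self, mul_inv_cancel_right, h0]
    simp)
  rw [mul_assoc, ht.mul_self, mul_one] at h
  exact lt_asymm h hlt

/-- For distinct commuting reflections `r` and `t`, multiplying by `r` does not change whether
`t` is a right inversion. -/
theorem IsReflection.length_mul_mul_lt_iff_of_commute {cs : CoxeterSystem M W} {r t : W}
    (hr : cs.IsReflection r) (ht : cs.IsReflection t) (h : Commute r t) (hne : r ≠ t) (w : W) :
    cs.length (w * r * t) < cs.length (w * r) ↔ cs.length (w * t) < cs.length w := by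
  rw [ht.length_mul_lt_iff, ht.length_mul_lt_iff, inversionCocycle_mul,
    hr.inversionCocycle_eq_zero_of_commute h.symm hne.symm, zero_add, h.eq, mul_inv_cancel_right]

end CoxeterSystem

/-- QP1 for perfect involutions: if `ι` is a perfect involution,
`r` a reflection, and `ℓ(rιr) = ℓ(ι)`, then `rιr = ι`. -/
theorem perfect_involution_qp1 (cs : CoxeterSystem M W) (ι : W)
    (hι : IsPerfectInvolution cs ι) (r : W) (hr : cs.IsReflection r)
    (hlen : cs.length (r * ι * r) = cs.length ι) :
    r * ι * r = ι := by
  obtain ⟨hsq, hperf⟩ := hι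
  have hinv : ι⁻¹ = ι := inv_eq_of_mul_eq_one_left hsq
  have hcomm := hperf r hr
  have ht : cs.IsReflection (ι * r * ι) := by simpa [hinv] using hr.conj ι
  have hιt : ι * (ι * r * ι) = r * ι := by rw [← mul_assoc, ← mul_assoc, hsq, one_mul]
  have hιrt : ι * r * (ι * r * ι) = r * ι * r := by
    rw [mul_assoc ι r, hcomm.eq, ← mul_assoc, hιt]
  by_cases hne : r = ι * r * ι
  · have hrι : r * ι = ι * r := by
      conv_lhs => rw [hne]
      rw [mul_assoc, hsq, mul_one]
    rw [hrι, mul_assoc, hr.mul_self, mul_one]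
  · exfalso
    have hlt := hr.length_mul_mul_lt_iff_of_commute ht hcomm hne ι
    have hrι : cs.length (r * ι) = cs.length (ι * r) := by
      rw [← cs.length_inv, mul_inv_rev, hinv, hr.inv]
    rw [hιrt, hιt, hrι, hlen] at hlt
    have := hr.length_mul_left_ne ι
    lia
end

section
/- Let (X, hgt) be a quasiparabolic W-set with Bruhat order ≤. If x, y ∈ X and s ∈ S satisfy x < y and s·y < s·x, then s·y = x. -/
open CoxeterSystem

variable {B W : Type*} [Group W] {M : CoxeterMatrix B}

/-- The Bruhat order on a quasiparabolic `W`-set: the reflexive–transitive closure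
of the relation `x ≺ r • x` for reflections `r` with `hgt x < hgt (r • x)`. -/
def BruhatLE (cs : CoxeterSystem M W) {X : Type*} [MulAction W X] (hgt : X → ℤ) :
    X → X → Prop :=
  Relation.ReflTransGen (fun x y => ∃ r : W, cs.IsReflection r ∧ y = r • x ∧ hgt x < hgt y)

/-- The strict Bruhat order. -/
def BruhatLT (cs : CoxeterSystem M W) {X : Type*} [MulAction W X] (hgt : X → ℤ)
    (x y : X) : Prop :=
  BruhatLE cs hgt x y ∧ x ≠ y

/-- Comparable elements in the Bruhat order are equal or have strictly increasing heights. -/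
theorem BruhatLE.eq_or_hgt_lt {cs : CoxeterSystem M W} {X : Type*} [MulAction W X]
    {hgt : X → ℤ} {x y : X} (h : BruhatLE cs hgt x y) : x = y ∨ hgt x < hgt y := by
  induction h with
  | refl => exact Or.inl rfl
  | tail _ hstep ih =>
    obtain ⟨_, _, _, hlt⟩ := hstep
    rcases ih with rfl | ih
    · exact Or.inr hlt
    · exact Or.inr (ih.trans hlt)

theorem BruhatLT.hgt_lt {cs : CoxeterSystem M W} {X : Type*} [MulAction W X]
    {hgt : X → ℤ} {x y : X} (h : BruhatLT cs hgt x y) : hgt x < hgt y :=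
  h.1.eq_or_hgt_lt.resolve_left h.2

/-- in a quasiparabolic `W`-set with Bruhat order, if `x < y` and
`s • y < s • x` for a simple reflection `s`, then `s • y = x`. -/
theorem bruhat_qp2 (cs : CoxeterSystem M W) {X : Type*} [MulAction W X]
    (hgt : X → ℤ) (hqp : IsQuasiparabolic cs hgt) (x y : X) (b : B)
    (hxy : BruhatLT cs hgt x y)
    (hsy : BruhatLT cs hgt (cs.simple b • y) (cs.simple b • x)) :
    cs.simple b • y = x := by
  obtain ⟨hscaled, -, hqp2⟩ := hqp
  have hslt := hsy.hgt_lt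
  have hx := abs_le.mp (hscaled b x)
  have hy := abs_le.mp (hscaled b y)
  rcases hxy.1.cases_head with h | ⟨z, ⟨r, hr, rfl, hz⟩, hzy⟩
  · exact absurd h hxy.2
  -- The heights of `x` and `y` differ by exactly one, so the chain has a single step.
  rcases BruhatLE.eq_or_hgt_lt hzy with rfl | hzy
  · rw [hqp2 r b x hr hz hslt, ← mul_smul, cs.simple_mul_simple_self, one_smul]
  · omega
end

section
/- Let W be a finite Coxeter group and H ⊆ W a quasiparabolic subgroup. Then the Poincaré polynomial PS_{W/H}(q) = Σ_{xH ∈ W/H} q^{hgt(xH)} divides the Poincaré polynomial PS_W(q) = Σ_{w ∈ W} q^{ℓ(w)} in the polynomial ring ℤ[q]. -/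
open CoxeterSystem

variable {B W : Type*} [Group W] {M : CoxeterMatrix B}

/-! ### Walks under a pair of involutions -/

/-- A bi-infinite sequence obtained by letting `s` and `t` act alternately, `s` leading from the
even positions to the next one. -/
def IsAltWalk {G X : Type*} [Group G] [MulAction G X] (s t : G) (y : ℤ → X) : Prop :=
  ∀ i : ℤ, y (i + 1) = (if Even i then s else t) • y i

namespace IsAltWalk

variable {G X : Type*} [Group G] [MulAction G X] {s t : G} {y : ℤ → X}

theorem exists_walk (s t : G) (x : X) : ∃ y : ℤ → X, IsAltWalk s t y ∧ y 0 = x := by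
  refine ⟨fun i => if Even i then (t * s) ^ (i / 2) • x else s • (t * s) ^ (i / 2) • x, ?_,
    by simp⟩
  intro i
  rcases Int.even_or_odd' i with ⟨k, rfl | rfl⟩
  · have h1 : (2 * k + 1) / 2 = k := by lia
    have h2 : 2 * k / 2 = k := by lia
    simp [h1, h2]
  · have h1 : (2 * k + 1) / 2 = k := by lia
    have h2 : (2 * k + 1 + 1) / 2 = 1 + k := by lia
    have h3 : Even (2 * k + 1 + 1) := ⟨k + 1, by ring⟩
    have h4 : ¬ Even (2 * k + 1) := by grind
    simp only [h1, h2, h3, h4, zpow_add, zpow_one, mul_smul, if_true, if_false]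

theorem neg (hs : s * s = 1) (ht : t * t = 1) (hy : IsAltWalk s t y) :
    IsAltWalk t s (fun i => y (-i)) := by
  intro i
  have h := hy (-i - 1)
  rw [sub_add_cancel] at h
  have e : -(i + 1) = -i - 1 := by ring
  beta_reduce
  rw [h, e]
  by_cases hi : Even i
  · have : ¬ Even (-i - 1) := by grind
    simp [hi, this, smul_smul, ht]
  · have : Even (-i - 1) := by grind
    simp [hi, this, smul_smul, hs]

theorem sub_one (hs : s * s = 1) (ht : t * t = 1) (hy : IsAltWalk s t y) (i : ℤ) :
    y (i - 1) = (if Even i then t else s) • y i := by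
  simpa [show -(-i + 1) = i - 1 by ring] using hy.neg hs ht (-i)

theorem eq_translate (hs : s * s = 1) (ht : t * t = 1) (hy : IsAltWalk s t y) {i j : ℤ}
    (hij : Even (i - j)) (h : y i = y j) (n : ℤ) : y (i + n) = y (j + n) := by
  induction n with
  | zero => simpa using h
  | succ n ih =>
    rw [← add_assoc, ← add_assoc, hy, hy, ih]
    have : Even (i + n) ↔ Even (j + n) := by grind
    simp [this]
  | pred n ih =>
    rw [← add_sub_assoc, ← add_sub_assoc, hy.sub_one hs ht, hy.sub_one hs ht (j + _), ih]
    have : Even (i + -(n : ℤ)) ↔ Even (j + -(n : ℤ)) := by grind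
    simp [this]

theorem eq_reflect (hs : s * s = 1) (ht : t * t = 1) (hy : IsAltWalk s t y) {i j : ℤ}
    (hij : Odd (i - j)) (h : y i = y j) (n : ℤ) : y (i + n) = y (j - n) := by
  induction n with
  | zero => simpa using h
  | succ n ih =>
    rw [← add_assoc, ← sub_sub, hy, hy.sub_one hs ht, ih]
    have : Even (i + n) ↔ ¬ Even (j - n) := by grind
    by_cases h : Even (j - (n : ℤ)) <;> simp [this, h]
  | pred n ih =>
    rw [← add_sub_assoc, show j - (-(n : ℤ) - 1) = j - -(n : ℤ) + 1 by ring, hy,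
      hy.sub_one hs ht, ih]
    have : Even (i + -(n : ℤ)) ↔ ¬ Even (j - -(n : ℤ)) := by grind
    by_cases h : Even (j - -(n : ℤ)) <;>
      simp only [this, h, not_true, not_false_eq_true, if_true, if_false]

theorem two_mul (hy : IsAltWalk s t y) (n : ℕ) : y (2 * n) = (t * s) ^ n • y 0 := by
  induction n with
  | zero => simp
  | succ n ih =>
    have e : (2 * ((n + 1 : ℕ) : ℤ)) = 2 * n + 1 + 1 := by push_cast; ring
    rw [e, hy, hy, ih, pow_succ']
    simp [mul_smul]

end IsAltWalk

/-- The properties of a height function along an alternating walk in a quasiparabolic set. -/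
structure IsQuasiparabolicWalk {X : Type*} (y : ℤ → X) (h : X → ℤ) : Prop where
  step : ∀ i, |h (y (i + 1)) - h (y i)| ≤ 1
  translate : ∀ i j, Even (i - j) → y i = y j → ∀ n, y (i + n) = y (j + n)
  reflect : ∀ i j, Odd (i - j) → y i = y j → ∀ n, y (i + n) = y (j - n)
  eq_of_height_eq : ∀ i j, Odd (i - j) → h (y i) = h (y j) → y i = y j
  exchange_right : ∀ i j, Odd (i - j) → h (y j) < h (y i) → h (y (i - 1)) < h (y (j + 1)) →
    y i = y (j + 1)
  exchange_left : ∀ i j, Odd (i - j) → h (y j) < h (y i) → h (y (i + 1)) < h (y (j - 1)) →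
    y i = y (j - 1)

namespace IsQuasiparabolicWalk

variable {X : Type*} {y : ℤ → X} {h : X → ℤ}

theorem mirror (hy : IsQuasiparabolicWalk y h) : IsQuasiparabolicWalk (fun i => y (-i)) h where
  step i := by
    have := hy.step (-(i + 1))
    rw [abs_sub_comm] at this
    simpa using this
  translate i j hij e n := by
    have := hy.translate (-i) (-j) (by grind) e (-n)
    simpa [neg_add, add_comm] using this
  reflect i j hij e n := by
    have := hy.reflect (-i) (-j) (by grind) e (-n)
    rw [neg_add, neg_sub', this]
  eq_of_height_eq i j hij e := hy.eq_of_height_eq _ _ (by grind) e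
  exchange_right i j hij h1 h2 := by
    have := hy.exchange_left (-i) (-j) (by grind) h1
      (by simpa only [show -i + 1 = -(i - 1) by ring, show -j - 1 = -(j + 1) by ring] using h2)
    rwa [show -j - 1 = -(j + 1) by ring] at this
  exchange_left i j hij h1 h2 := by
    have := hy.exchange_right (-i) (-j) (by grind) h1
      (by simpa only [show -i - 1 = -(i + 1) by ring, show -j + 1 = -(j - 1) by ring] using h2)
    rwa [show -j + 1 = -(j - 1) by ring] at this

theorem neg_height (hy : IsQuasiparabolicWalk y h) :
    IsQuasiparabolicWalk y (fun x => - h x) where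
  step i := by
    have := hy.step i
    rw [abs_sub_comm] at this
    simpa [sub_eq_add_neg, add_comm] using this
  translate := hy.translate
  reflect := hy.reflect
  eq_of_height_eq i j hij e := hy.eq_of_height_eq i j hij (neg_injective e)
  exchange_right i j hij h1 h2 := by
    have := hy.exchange_left j i (by grind) (by simpa using h1) (by simpa using h2)
    simpa using (hy.translate j (i - 1) (by grind) this 1).symm
  exchange_left i j hij h1 h2 := by
    have := hy.exchange_right j i (by grind) (by simpa using h1) (by simpa using h2)
    simpa [← sub_eq_add_neg] using (hy.translate j (i + 1) (by grind) this (-1)).symm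

/-- A periodic walk starting at a local minimum climbs up to a first peak. -/
theorem exists_peak (hy : IsQuasiparabolicWalk y h) {m : ℕ} (hm : 0 < m)
    (hper : y (2 * m) = y 0) :
    ∃ a : ℕ, (∀ i : ℤ, 0 ≤ i → i ≤ a → h (y i) = h (y 0) + i) ∧ h (y (a + 1)) ≤ h (y a) := by
  classical
  have hex : ∃ a : ℕ, h (y (a + 1)) ≤ h (y a) := by
    by_contra! hcon
    have key : ∀ n : ℕ, h (y 0) + n ≤ h (y n) := by
      intro n
      induction n with
      | zero => simp
      | succ n ih => have := hcon n; push_cast; lia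
    have := key (2 * m)
    push_cast at this
    rw [hper] at this
    lia
  refine ⟨Nat.find hex, ?_, Nat.find_spec hex⟩
  have key : ∀ n : ℕ, n ≤ Nat.find hex → h (y n) = h (y 0) + n := by
    intro n hn
    induction n with
    | zero => simp
    | succ n ih =>
      have h1 := Nat.find_min hex (show n < Nat.find hex by lia)
      have h2 := abs_le.1 (hy.step n)
      have h3 := ih (by lia)
      push_cast
      lia
  intro i hi hia
  lift i to ℕ using hi
  exact key i (by exact_mod_cast hia)

/-- Two climbs of equal positive length, the second of which cannot be continued, end in the same
point. -/
theorem climbs_meet (hy : IsQuasiparabolicWalk y h) {b : ℤ} (hb : 0 < b)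
    (hr : ∀ i : ℤ, 0 ≤ i → i ≤ b → h (y i) = h (y 0) + i)
    (hl : ∀ i : ℤ, 0 ≤ i → i ≤ b → h (y (-i)) = h (y 0) + i)
    (hpeak : h (y (-b - 1)) ≤ h (y (-b))) : y b = y (-b) := by
  have hstep := abs_le.1 (hy.step (-b - 1))
  rw [sub_add_cancel] at hstep
  have h1 := hr b hb.le le_rfl
  have h2 := hl b hb.le le_rfl
  have h3 := hr (b - 1) (by lia) (by lia)
  rcases hpeak.lt_or_eq with hlt | heq
  · have := hy.exchange_right b (-b - 1) ⟨b, by ring⟩ (by lia) (by rw [sub_add_cancel]; lia)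
    rwa [sub_add_cancel] at this
  · have e1 := hy.eq_of_height_eq _ _ (by grind) heq
    rw [← e1]
    exact hy.eq_of_height_eq _ _ ⟨b, by ring⟩ (by lia)

/-- If the climb to one side of a local minimum is not longer than that to the other one, either
both have the same length and meet, or the shorter one is trivial. -/
theorem climbs_cases (hy : IsQuasiparabolicWalk y h) {a b : ℤ} (hb : 0 ≤ b) (hba : b ≤ a)
    (hr : ∀ i : ℤ, 0 ≤ i → i ≤ a → h (y i) = h (y 0) + i)
    (hl : ∀ i : ℤ, 0 ≤ i → i ≤ b → h (y (-i)) = h (y 0) + i)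
    (hpeak : h (y (-b - 1)) ≤ h (y (-b))) : b = 0 ∨ (0 < b ∧ b = a ∧ y b = y (-b)) := by
  rcases hb.eq_or_lt with hb0 | hb0
  · exact .inl hb0.symm
  have e := hy.climbs_meet hb0 (fun i h1 h2 => hr i h1 (h2.trans hba)) hl hpeak
  refine .inr ⟨hb0, ?_, e⟩
  by_contra hne
  have e1 := hy.translate _ _ (by grind) e 1
  have h1 := hr (b + 1) (by lia) (by lia)
  have h2 := hl (b - 1) (by lia) (by lia)
  rw [show -(b - 1) = -b + 1 by ring, ← e1] at h2
  lia

theorem path_top (hy : IsQuasiparabolicWalk y h) {a : ℤ} (ha : 0 ≤ a) (h0 : y (-1) = y 0)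
    (hmin : h (y 0) ≤ h (y 1))
    (hr : ∀ i : ℤ, 0 ≤ i → i ≤ a → h (y i) = h (y 0) + i)
    (hpeak : h (y (a + 1)) ≤ h (y a)) : y (a + 1) = y a := by
  rcases hpeak.eq_or_lt with heq | hlt
  · exact hy.eq_of_height_eq _ _ (by grind) heq
  exfalso
  have hstep := abs_le.1 (hy.step a)
  have h1 : 0 < a := by
    rcases ha.eq_or_lt with rfl | h1
    · rw [zero_add] at hlt
      lia
    · exact h1
  have h2 := hr (a - 1) (by lia) (by lia)
  have h3 := hr a (by lia) (by lia)
  have h4 := hy.reflect (-1) 0 (by decide) h0 (-(a - 1))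
  have h5 := hy.eq_of_height_eq (-a) (a + 1) (by grind)
    (by rw [show -a = -1 + -(a - 1) by ring, h4, sub_neg_eq_add, zero_add]; lia)
  have h6 : y (a + 1) = y (a - 1) := by
    rw [← h5, show -a = -1 + -(a - 1) by ring, h4, sub_neg_eq_add, zero_add]
  have h7 := hy.translate _ _ (by grind) h6 (-a)
  rw [show a + 1 + -a = 1 by ring, show a - 1 + -a = -1 by ring, h0] at h7
  have h8 := hr 1 (by lia) (by lia)
  rw [h7] at h8
  lia

theorem periodic (hy : IsQuasiparabolicWalk y h) {i j : ℤ} (hij : Even (i - j)) (e : y i = y j) :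
    Function.Periodic y (i - j) := by
  intro n
  have := hy.translate i j hij e (n - j)
  rwa [show i + (n - j) = n + (i - j) by ring, show j + (n - j) = n by ring] at this

end IsQuasiparabolicWalk

theorem dvd_of_periodic_two_mul {X : Type*} {y : ℤ → X} {k m : ℕ} (hk : 0 < k)
    (hyk : Function.Periodic y (2 * k)) (hym : Function.Periodic y (2 * m))
    (hmin : ∀ d : ℤ, 0 < d → d < k → ∃ i, y (i + 2 * d) ≠ y i) : k ∣ m := by
  rw [← Int.natCast_dvd_natCast, Int.dvd_iff_emod_eq_zero]
  by_contra hne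
  have hk' : (0 : ℤ) < k := by exact_mod_cast hk
  have h1 := Int.emod_nonneg (m : ℤ) hk'.ne'
  obtain ⟨i, hi⟩ := hmin ((m : ℤ) % k) (by lia) (Int.emod_lt_of_pos _ hk')
  refine hi ?_
  have h2 := hym.sub_period (hyk.int_mul ((m : ℤ) / k)) i
  rw [← h2, Int.emod_def]
  congr 1
  push_cast
  ring

/-- Both climbs from `y 0` have length `k` and end in the same point. -/
def IsCycleClimb {X : Type*} (y : ℤ → X) (h : X → ℤ) (k : ℕ) : Prop :=
  y k = y (-k) ∧ ∀ i : ℤ, 0 ≤ i → i ≤ k → h (y i) = h (y 0) + i ∧ h (y (-i)) = h (y 0) + i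

/-- The walk is stationary before `y 0`, and climbs from there until it is stationary again. -/
def IsPathClimb {X : Type*} (y : ℤ → X) (h : X → ℤ) (k : ℕ) : Prop :=
  y (-1) = y 0 ∧ y k = y (k - 1) ∧ ∀ i : ℤ, 0 ≤ i → i < k → h (y i) = h (y 0) + i

namespace IsQuasiparabolicWalk

variable {X : Type*} {y : ℤ → X} {h : X → ℤ}

theorem dvd_of_isCycleClimb (hy : IsQuasiparabolicWalk y h) {k m : ℕ} (hk : 0 < k)
    (hper : Function.Periodic y (2 * m)) (hc : IsCycleClimb y h k) : k ∣ m := by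
  obtain ⟨e, hh⟩ := hc
  have hp : Function.Periodic y (2 * k) := by
    simpa [← _root_.two_mul] using hy.periodic (i := k) (j := -k) (by grind) e
  refine dvd_of_periodic_two_mul hk hp hper fun d hd hdk => ⟨k - 2 * d, fun hcon => ?_⟩
  rw [sub_add_cancel] at hcon
  have h1 := (hh k (by lia) le_rfl).1
  rw [hcon] at h1
  rcases le_total 0 ((k : ℤ) - 2 * d) with h2 | h2
  · have := (hh _ h2 (by lia)).1
    lia
  · have := (hh (-((k : ℤ) - 2 * d)) (by lia) (by lia)).2
    rw [neg_neg] at this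
    lia

theorem dvd_of_isPathClimb (hy : IsQuasiparabolicWalk y h) {k m : ℕ} (hk : 0 < k)
    (hper : Function.Periodic y (2 * m)) (hc : IsPathClimb y h k) : k ∣ m := by
  obtain ⟨e0, e, hh⟩ := hc
  have hrefl : ∀ n : ℤ, y (-1 - n) = y n := fun n => by
    simpa [sub_eq_add_neg] using hy.reflect (-1) 0 (by decide) e0 (-n)
  have e' : y k = y (-k) := by
    rw [e, ← hrefl]
    congr 1
    ring
  have hp : Function.Periodic y (2 * k) := by
    simpa [← _root_.two_mul] using hy.periodic (i := k) (j := -k) (by grind) e'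
  refine dvd_of_periodic_two_mul hk hp hper fun d hd hdk => ⟨k - 1 - 2 * d, fun hcon => ?_⟩
  rw [sub_add_cancel] at hcon
  have h1 := hh (k - 1) (by lia) (by lia)
  rw [hcon] at h1
  rcases le_or_gt 0 ((k : ℤ) - 1 - 2 * d) with h2 | h2
  · have := hh _ h2 (by lia)
    lia
  · have := hh (-1 - ((k : ℤ) - 1 - 2 * d)) (by lia) (by lia)
    rw [hrefl] at this
    lia

/-- The shape of a periodic walk around a local minimum. -/
theorem exists_climb (hy : IsQuasiparabolicWalk y h) {m : ℕ} (hm : 0 < m)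
    (hper : y (2 * m) = y 0) (hmin : h (y 0) ≤ h (y 1)) (hmin' : h (y 0) ≤ h (y (-1))) :
    ∃ k : ℕ, 0 < k ∧ k ∣ m ∧
      (IsCycleClimb y h k ∨ IsPathClimb y h k ∨ IsPathClimb (fun i => y (-i)) h k) := by
  have hP : Function.Periodic y (2 * m) := by
    simpa using hy.periodic (i := 2 * m) (j := 0) (by simp) hper
  have hper' : y (-(2 * m)) = y 0 := by simpa using (hP.neg 0)
  have hP' : Function.Periodic (fun i => y (-i)) (2 * m) := fun i => by
    simpa [neg_add, add_comm] using hP.neg (-i)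
  obtain ⟨a, ha, hapeak⟩ := hy.exists_peak hm hper
  obtain ⟨b, hb, hbpeak⟩ := hy.mirror.exists_peak hm hper'
  simp only [neg_zero, neg_add'] at hb hbpeak
  suffices key : ∀ {y : ℤ → X} (hy : IsQuasiparabolicWalk y h) {a b : ℕ}
      (hP : Function.Periodic y (2 * m)) (hmin : h (y 0) ≤ h (y 1))
      (hmin' : h (y 0) ≤ h (y (-1))) (hba : b ≤ a)
      (ha : ∀ i : ℤ, 0 ≤ i → i ≤ a → h (y i) = h (y 0) + i)
      (hb : ∀ i : ℤ, 0 ≤ i → i ≤ b → h (y (-i)) = h (y 0) + i)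
      (hapeak : h (y (a + 1)) ≤ h (y a)) (hbpeak : h (y (-b - 1)) ≤ h (y (-b))),
      ∃ k : ℕ, 0 < k ∧ k ∣ m ∧ (IsCycleClimb y h k ∨ IsPathClimb y h k) by
    rcases le_total b a with hba | hab
    · obtain ⟨k, hk, hkm, hc | hc⟩ := key hy hP hmin hmin' hba ha hb hapeak hbpeak
      exacts [⟨k, hk, hkm, .inl hc⟩, ⟨k, hk, hkm, .inr (.inl hc)⟩]
    · obtain ⟨k, hk, hkm, hc | hc⟩ := key hy.mirror hP' (by simpa using hmin')
        (by simpa using hmin) hab (by simpa using hb) (by simpa using ha)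
        (by simpa only [neg_add'] using hbpeak)
        (by simpa [neg_sub, add_comm] using hapeak)
      · refine ⟨k, hk, hkm, .inl ⟨by simpa using hc.1.symm, fun i h1 h2 => ?_⟩⟩
        simpa using (hc.2 i h1 h2).symm
      · exact ⟨k, hk, hkm, .inr (.inr hc)⟩
  intro y hy a b hP hmin hmin' hba ha hb hapeak hbpeak
  rcases hy.climbs_cases (a := a) (b := b) (by lia) (by lia) ha hb hbpeak with hb0 | ⟨hb0, hab, e⟩
  · have h0 : y (-1) = y 0 := by
      rw [hb0] at hbpeak
      refine hy.eq_of_height_eq _ _ (by decide) (le_antisymm (by simpa using hbpeak) hmin')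
    have htop := hy.path_top (by lia) h0 hmin ha hapeak
    have hc : IsPathClimb y h (a + 1) :=
      ⟨h0, by simpa using htop, fun i h1 h2 => ha i h1 (by push_cast at h2; lia)⟩
    exact ⟨a + 1, by lia, hy.dvd_of_isPathClimb (by lia) hP hc, .inr hc⟩
  · have hab' : b = a := by exact_mod_cast hab
    subst hab'
    have hb1 : 0 < b := by exact_mod_cast hb0
    have hc : IsCycleClimb y h b := ⟨e, fun i h1 h2 => ⟨ha i h1 h2, hb i h1 h2⟩⟩
    exact ⟨b, hb1, hy.dvd_of_isCycleClimb hb1 hP hc, .inl hc⟩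

end IsQuasiparabolicWalk

/-! ### Alternating walks in quasiparabolic sets -/

/-- Points of an alternating walk at odd distance are related by a reflection. -/
theorem IsAltWalk.exists_reflection (cs : CoxeterSystem M W) {X : Type*} [MulAction W X] {a b : B}
    {y : ℤ → X} (hy : IsAltWalk (cs.simple a) (cs.simple b) y) {i j : ℤ} (hij : Odd (i - j)) :
    ∃ r, cs.IsReflection r ∧ r • y j = y i := by
  have ha := cs.simple_mul_simple_self a
  have hb := cs.simple_mul_simple_self b
  have key : ∀ (n : ℕ) (c : ℤ), ∃ r, cs.IsReflection r ∧ r • y (c - n) = y (c + n + 1) := by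
    intro n c
    induction n with
    | zero =>
      refine ⟨if Even c then cs.simple a else cs.simple b, ?_, ?_⟩
      · split_ifs <;> exact cs.isReflection_simple _
      · simpa using (hy c).symm
    | succ n ih =>
      obtain ⟨r, hr, e⟩ := ih
      have h1 := hy (c + n + 1)
      have h2 := hy (c - n - 1)
      rw [sub_add_cancel] at h2
      have h3 : Even (c + n + 1) ↔ Even (c - n - 1) := by grind
      rw [← e, h2, smul_smul, smul_smul] at h1
      rw [show c - ((n + 1 : ℕ) : ℤ) = c - n - 1 by push_cast; ring,
        show c + ((n + 1 : ℕ) : ℤ) + 1 = c + n + 1 + 1 by push_cast; ring]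
      refine Exists.intro _ (And.intro ?_ h1.symm)
      simp only [h3]
      split_ifs
      · simpa using hr.conj (cs.simple a)
      · simpa using hr.conj (cs.simple b)
  obtain ⟨n, hn⟩ := hij
  rcases le_total 0 n with h0 | h0
  · lift n to ℕ using h0
    obtain ⟨r, hr, e⟩ := key n (j + n)
    refine ⟨r, hr, ?_⟩
    rwa [add_sub_cancel_right, show j + n + n + 1 = i by lia] at e
  · obtain ⟨k, rfl | hk⟩ : ∃ k : ℕ, n = 0 ∨ n = -(k + 1) := ⟨(-n - 1).toNat, by lia⟩
    · obtain ⟨r, hr, e⟩ := key 0 j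
      refine ⟨r, hr, ?_⟩
      simpa [show i = j + 1 by lia] using e
    · obtain ⟨r, hr, e⟩ := key k (i + k)
      refine ⟨r, hr, ?_⟩
      rw [add_sub_cancel_right, show i + k + k + 1 = j by lia] at e
      rw [← e, smul_smul, hr.mul_self, one_smul]

theorem IsQuasiparabolic.isQuasiparabolicWalk {cs : CoxeterSystem M W} {X : Type*} [MulAction W X]
    {hgt : X → ℤ} (hX : IsQuasiparabolic cs hgt) {a b : B} {y : ℤ → X}
    (hy : IsAltWalk (cs.simple a) (cs.simple b) y) : IsQuasiparabolicWalk y hgt where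
  step i := by
    rw [hy i]
    split_ifs <;> exact hX.1 _ _
  translate _ _ hij e n :=
    hy.eq_translate (cs.simple_mul_simple_self a) (cs.simple_mul_simple_self b) hij e n
  reflect _ _ hij e n :=
    hy.eq_reflect (cs.simple_mul_simple_self a) (cs.simple_mul_simple_self b) hij e n
  eq_of_height_eq i j hij e := by
    obtain ⟨r, hr, hrj⟩ := hy.exists_reflection cs hij
    rw [← hrj] at e ⊢
    exact hX.2.1 r _ hr e
  exchange_right i j hij h1 h2 := by
    obtain ⟨r, hr, hrj⟩ := hy.exists_reflection cs hij
    have e1 := hy.sub_one (cs.simple_mul_simple_self a) (cs.simple_mul_simple_self b) i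
    have e2 := hy j
    have hpar : Even i ↔ ¬ Even j := by grind
    rw [e1, e2, ← hrj] at h2
    rw [← hrj] at h1
    rw [e2, ← hrj]
    by_cases hj : Even j <;>
      simp only [hpar, hj, not_true, not_false_eq_true, if_true, if_false] at h2 ⊢
    · exact hX.2.2 r a _ hr h1 h2
    · exact hX.2.2 r b _ hr h1 h2
  exchange_left i j hij h1 h2 := by
    obtain ⟨r, hr, hrj⟩ := hy.exists_reflection cs hij
    have e1 := hy.sub_one (cs.simple_mul_simple_self a) (cs.simple_mul_simple_self b) j
    have e2 := hy i
    have hpar : Even i ↔ ¬ Even j := by grind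
    rw [e1, e2, ← hrj] at h2
    rw [← hrj] at h1
    rw [e1, ← hrj]
    by_cases hj : Even j <;>
      simp only [hpar, hj, not_true, not_false_eq_true, if_true, if_false] at h2 ⊢
    · exact hX.2.2 r b _ hr h1 h2
    · exact hX.2.2 r a _ hr h1 h2

/-! ### The left regular action is quasiparabolic -/

namespace CoxeterSystem

variable (cs : CoxeterSystem M W)

open Classical in
/-- The permutation of `W × ZMod 2` by which a simple reflection records whether it
makes a given reflection an inversion. -/
noncomputable def signPerm (b : B) : Equiv.Perm (W × ZMod 2) :=
  Function.Involutive.toPerm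
    (fun p => (cs.simple b * p.1 * cs.simple b, p.2 + if p.1 = cs.simple b then 1 else 0)) <| by
    rintro ⟨r, e⟩
    have h : cs.simple b * r * cs.simple b = cs.simple b ↔ r = cs.simple b := by
      constructor
      · intro h
        simpa [mul_assoc] using congrArg (fun w => cs.simple b * w * cs.simple b) h
      · rintro rfl
        simp
    ext
    · simp [mul_assoc]
    · simp [h, add_assoc, CharTwo.add_self_eq_zero]

open Classical in
theorem signPerm_apply (b : B) (r : W) (e : ZMod 2) :
    cs.signPerm b (r, e) =
      (cs.simple b * r * cs.simple b, e + if r = cs.simple b then 1 else 0) := rfl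

open Classical in
theorem signPerm_mul_pow_apply (a b : B) (n : ℕ) (r : W) (e : ZMod 2) :
    ((cs.signPerm a * cs.signPerm b) ^ n) (r, e) =
      ((cs.simple a * cs.simple b) ^ n * r * ((cs.simple a * cs.simple b) ^ n)⁻¹,
        e + ∑ i ∈ Finset.range (2 * n),
          if r = (cs.simple b * cs.simple a) ^ i * cs.simple b then 1 else 0) := by
  have hinv : ∀ n : ℕ, ((cs.simple a * cs.simple b) ^ n)⁻¹ = (cs.simple b * cs.simple a) ^ n := by
    intro n
    rw [← inv_pow, mul_inv_rev, cs.inv_simple, cs.inv_simple]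
  have hcomm : ∀ n : ℕ, cs.simple b * (cs.simple a * cs.simple b) ^ n =
      (cs.simple b * cs.simple a) ^ n * cs.simple b := by
    intro n
    induction n with
    | zero => simp
    | succ n ih => rw [pow_succ, ← mul_assoc, ih, pow_succ]; simp only [mul_assoc]
  induction n with
  | zero => simp
  | succ n ih =>
    rw [pow_succ', Equiv.Perm.mul_apply, ih]
    set g := (cs.simple a * cs.simple b) ^ n with hg
    have h1 : g * r * g⁻¹ = cs.simple b ↔
        r = (cs.simple b * cs.simple a) ^ (2 * n) * cs.simple b := by
      have : (cs.simple b * cs.simple a) ^ (2 * n) * cs.simple b = g⁻¹ * cs.simple b * g := by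
        rw [_root_.two_mul, pow_add, mul_assoc, ← hcomm, hinv, ← mul_assoc]
      rw [this]
      constructor
      · intro h
        rw [← h]
        group
      · rintro rfl
        group
    have h2 : cs.simple b * (g * r * g⁻¹) * cs.simple b = cs.simple a ↔
        r = (cs.simple b * cs.simple a) ^ (2 * n + 1) * cs.simple b := by
      have : (cs.simple b * cs.simple a) ^ (2 * n + 1) * cs.simple b =
          g⁻¹ * (cs.simple b * cs.simple a * cs.simple b) * g := by
        rw [show 2 * n + 1 = n + 1 + n by ring, pow_add, mul_assoc, ← hcomm, hinv, pow_succ, hg]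
        simp only [mul_assoc]
      rw [this]
      constructor
      · intro h
        rw [← h]
        simp [mul_assoc]
      · rintro rfl
        simp [mul_assoc]
    rw [show 2 * (n + 1) = 2 * n + 1 + 1 by ring, Finset.sum_range_succ, Finset.sum_range_succ]
    simp only [Equiv.Perm.mul_apply, signPerm_apply, h1, h2]
    ext
    · simp [pow_succ', mul_assoc, ← hg]
    · simp only [add_assoc]

theorem isLiftable_signPerm : M.IsLiftable cs.signPerm := by
  classical
  intro a b
  ext1 ⟨r, e⟩
  rw [signPerm_mul_pow_apply, _root_.two_mul, Finset.sum_range_add]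
  simp [pow_add, CharTwo.add_self_eq_zero]

/-- The homomorphism extending `signPerm`. -/
noncomputable def signHom : W →* Equiv.Perm (W × ZMod 2) :=
  cs.lift ⟨cs.signPerm, cs.isLiftable_signPerm⟩

theorem signHom_simple (b : B) : cs.signHom (cs.simple b) = cs.signPerm b :=
  cs.lift_apply_simple _ b

open Classical in
theorem signHom_wordProd_inv_apply (ω : List B) (r : W) (e : ZMod 2) :
    cs.signHom (cs.wordProd ω)⁻¹ (r, e) =
      ((cs.wordProd ω)⁻¹ * r * cs.wordProd ω, e + (cs.leftInvSeq ω).count r) := by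
  induction ω generalizing r e with
  | nil => simp
  | cons b ω ih =>
    have hinj : Function.Injective (MulAut.conj (cs.simple b)) := (MulAut.conj _).injective
    have hcount : ((cs.leftInvSeq ω).map (MulAut.conj (cs.simple b))).count r =
        (cs.leftInvSeq ω).count (cs.simple b * r * cs.simple b) := by
      rw [← List.count_map_of_injective (cs.leftInvSeq ω) _ hinj]
      congr 1
      simp [mul_assoc]
    rw [cs.wordProd_cons, mul_inv_rev, map_mul, Equiv.Perm.mul_apply, cs.inv_simple,
      signHom_simple, signPerm_apply, ih, leftInvSeq, List.count_cons,
      hcount]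
    ext
    · simp [mul_assoc]
    · by_cases h : r = cs.simple b
      · simp [h]
        ring
      · simp [h, Ne.symm h]

/-- The parity recording whether `r` is a left inversion of `w`. -/
noncomputable def inversionParity (w r : W) : ZMod 2 := (cs.signHom w⁻¹ (r, 0)).2

theorem signHom_inv_apply (w r : W) (e : ZMod 2) :
    cs.signHom w⁻¹ (r, e) = (w⁻¹ * r * w, e + cs.inversionParity w r) := by
  obtain ⟨ω, rfl⟩ := cs.wordProd_surjective w
  rw [inversionParity, signHom_wordProd_inv_apply, signHom_wordProd_inv_apply, zero_add]

theorem inversionParity_mul (u w r : W) :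
    cs.inversionParity (u * w) r = cs.inversionParity u r + cs.inversionParity w (u⁻¹ * r * u) := by
  rw [inversionParity, mul_inv_rev, map_mul, Equiv.Perm.mul_apply, signHom_inv_apply,
    signHom_inv_apply, zero_add]

open Classical in
theorem inversionParity_simple (b : B) (r : W) :
    cs.inversionParity (cs.simple b) r = if r = cs.simple b then 1 else 0 := by
  rw [inversionParity, inv_simple, signHom_simple, signPerm_apply, zero_add]

theorem inversionParity_self {r : W} (hr : cs.IsReflection r) : cs.inversionParity r r = 1 := by
  obtain ⟨w, b, rfl⟩ := hr
  have h1 := cs.inversionParity_mul w w⁻¹ (w * cs.simple b * w⁻¹)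
  have h2 : cs.inversionParity 1 (w * cs.simple b * w⁻¹) = 0 := by simp [inversionParity]
  rw [mul_inv_cancel, h2] at h1
  rw [mul_assoc w, inversionParity_mul, inversionParity_mul, inversionParity_simple]
  have e1 : w⁻¹ * (w * (cs.simple b * w⁻¹)) * w = cs.simple b := by group
  have e2 : w⁻¹ * (w * cs.simple b * w⁻¹) * w = cs.simple b := by group
  rw [e2, mul_assoc w] at h1
  rw [e1]
  simp only [if_true, inv_simple, simple_mul_simple_self, one_mul]
  linear_combination -h1

theorem length_mul_lt_of_inversionParity_eq_one {w r : W} (h : cs.inversionParity w r = 1) :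
    cs.length (r * w) < cs.length w := by
  classical
  obtain ⟨ω, hω, rfl⟩ := cs.exists_isReduced w
  refine (cs.isLeftInversion_of_mem_leftInvSeq hω ?_).2
  by_contra hmem
  rw [inversionParity, signHom_wordProd_inv_apply, List.count_eq_zero_of_not_mem hmem] at h
  simp at h

theorem inversionParity_eq_one_iff {w r : W} (hr : cs.IsReflection r) :
    cs.inversionParity w r = 1 ↔ cs.length (r * w) < cs.length w := by
  refine ⟨cs.length_mul_lt_of_inversionParity_eq_one, fun h => ?_⟩
  by_contra hne
  have h0 : cs.inversionParity w r = 0 := by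
    generalize cs.inversionParity w r = z at hne
    revert z
    decide
  have h1 : cs.inversionParity (r * w) r = 1 := by
    rw [inversionParity_mul, cs.inversionParity_self hr]
    simp [h0]
  have := cs.length_mul_lt_of_inversionParity_eq_one h1
  rw [← mul_assoc, hr.mul_self, one_mul] at this
  exact this.asymm h

/-- The left regular action, with the length as height function, is quasiparabolic. -/
theorem isQuasiparabolic_length : IsQuasiparabolic cs (fun w : W => (cs.length w : ℤ)) := by
  refine ⟨fun b x => ?_, fun r x hr h => ?_, fun r b x hr h1 h2 => ?_⟩
  · rw [abs_le, smul_eq_mul]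
    rcases cs.length_simple_mul x b with h | h <;> lia
  · exact absurd (Nat.cast_injective h) (hr.length_mul_right_ne x)
  · simp only [smul_eq_mul, Nat.cast_lt] at h1 h2 ⊢
    have h3 := (cs.inversionParity_eq_one_iff (w := x) hr).not.2 h1.not_gt
    have hr' : cs.IsReflection (cs.simple b * r * cs.simple b) := by
      simpa using hr.conj (cs.simple b)
    have h4 := (cs.inversionParity_eq_one_iff (w := cs.simple b * x) hr').2
      (by simpa [mul_assoc] using h2)
    rw [inversionParity_mul, inversionParity_simple] at h4
    by_cases h5 : cs.simple b * r * cs.simple b = cs.simple b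
    · have : r = cs.simple b := by
        simpa [mul_assoc] using congrArg (fun w => cs.simple b * w * cs.simple b) h5
      rw [this]
    · refine absurd ?_ h3
      rw [if_neg h5, zero_add] at h4
      simpa [mul_assoc] using h4

end CoxeterSystem

/-! ### Alternating products of operators satisfying a quadratic relation -/

/-- The alternating product of length `n` whose rightmost factor is `a`. -/
def altProd {A : Type*} [Monoid A] : A → A → ℕ → A
  | _, _, 0 => 1
  | a, b, n + 1 => altProd b a n * a

section altProd

variable {R V : Type*} [CommRing R] [AddCommGroup V] [Module R V]

theorem altProd_succ {A : Type*} [Monoid A] (a b : A) (n : ℕ) :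
    altProd a b (n + 1) = altProd b a n * a := rfl

theorem altProd_succ' {A : Type*} [Monoid A] (a b : A) (n : ℕ) :
    altProd a b (n + 1) = (if Even n then a else b) * altProd a b n := by
  induction n generalizing a b with
  | zero => simp [altProd]
  | succ n ih =>
    rw [altProd_succ, ih, mul_assoc, ← altProd_succ]
    by_cases hn : Even n <;> simp [hn, Nat.even_add_one]

theorem altProd_add {A : Type*} [Monoid A] (a b : A) (m n : ℕ) :
    altProd a b (m + n) = (if Even n then altProd a b m else altProd b a m) * altProd a b n := by
  induction n generalizing a b with
  | zero => simp [altProd]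
  | succ n ih =>
    rw [← add_assoc, altProd_succ, ih, mul_assoc, ← altProd_succ]
    by_cases hn : Even n <;> simp [hn, Nat.even_add_one]

theorem altProd_apply_seq (a b : Module.End R V) (g : ℕ → V) (n : ℕ)
    (hg : ∀ i < n, g (i + 1) = (if Even i then a else b) (g i)) : altProd a b n (g 0) = g n := by
  induction n with
  | zero => simp [altProd]
  | succ n ih =>
    rw [altProd_succ', Module.End.mul_apply, ih fun i hi => hg i (by lia), ← hg n (by lia)]

theorem altProd_comm_apply {q : R} {a b : Module.End R V} (ha : a * a = (q - 1) • a + q • 1)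
    (hb : b * b = (q - 1) • b + q • 1) {k : ℕ} (hk : 0 < k) {v : V}
    (h : altProd a b k v = altProd b a k v) : altProd a b k (a v) = altProd b a k (a v) := by
  obtain ⟨j, rfl⟩ : ∃ j, k = j + 1 := ⟨k - 1, by lia⟩
  set c := if Even j then b else a with hc
  have hcc : c * c = (q - 1) • c + q • 1 := by
    rw [hc]
    split_ifs <;> assumption
  have h1 : altProd b a (j + 1) = c * altProd b a j := altProd_succ' b a j
  have h2 : altProd a b (j + 1 + 1) = c * altProd a b (j + 1) := by
    rw [altProd_succ', hc]
    by_cases hj : Even j <;> simp [hj, Nat.even_add_one]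
  calc altProd a b (j + 1) (a v) = altProd b a j ((a * a) v) := rfl
    _ = (q - 1) • altProd a b (j + 1) v + q • altProd b a j v := by simp [ha, altProd]
    _ = (c * c) (altProd b a j v) := by rw [h, h1, hcc]; simp
    _ = c (altProd b a (j + 1) v) := by rw [h1]; rfl
    _ = altProd a b (j + 1 + 1) v := by rw [h2, ← h]; rfl
    _ = altProd b a (j + 1) (a v) := rfl

theorem altProd_comm_altProd_apply {q : R} {a b : Module.End R V}
    (ha : a * a = (q - 1) • a + q • 1) (hb : b * b = (q - 1) • b + q • 1) {k : ℕ} (hk : 0 < k)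
    {v : V} (h : altProd a b k v = altProd b a k v) (n : ℕ) :
    altProd a b k (altProd a b n v) = altProd b a k (altProd a b n v) := by
  induction n with
  | zero => simpa [altProd] using h
  | succ n ih =>
    rw [altProd_succ', Module.End.mul_apply]
    split_ifs
    · exact altProd_comm_apply ha hb hk ih
    · exact (altProd_comm_apply hb ha hk ih.symm).symm

theorem altProd_comm_of_dvd {q : R} {a b : Module.End R V} (ha : a * a = (q - 1) • a + q • 1)
    (hb : b * b = (q - 1) • b + q • 1) {k m : ℕ} (hk : 0 < k) (hkm : k ∣ m) {v : V}
    (h : altProd a b k v = altProd b a k v) : altProd a b m v = altProd b a m v := by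
  obtain ⟨j, rfl⟩ := hkm
  induction j with
  | zero => simp [altProd]
  | succ j ih =>
    rw [Nat.mul_succ, add_comm, altProd_add, altProd_add]
    have h1 := altProd_comm_altProd_apply ha hb hk h (k * j)
    simp only [Module.End.mul_apply]
    rw [← ih]
    split_ifs
    · exact h1
    · exact h1.symm

end altProd

/-! ### Hecke operators -/

section heckeOp

variable {G X R : Type*} [Group G] [MulAction G X] [CommRing R]

/-- The operator by which an involution acts on the functions on a set with a height function,
deforming the permutation action. -/
def heckeOp (h : X → ℕ) (q : R) (g : G) : Module.End R (X → R) where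
  toFun v x := if h x < h (g • x) then q * v (g • x)
    else if h (g • x) < h x then v (g • x) + (q - 1) * v x else q * v x
  map_add' u v := by
    ext x
    simp only [Pi.add_apply]
    split_ifs <;> ring
  map_smul' c v := by
    ext x
    simp only [Pi.smul_apply, smul_eq_mul, RingHom.id_apply]
    split_ifs <;> ring

theorem heckeOp_apply (h : X → ℕ) (q : R) (g : G) (v : X → R) (x : X) :
    heckeOp h q g v x = if h x < h (g • x) then q * v (g • x)
      else if h (g • x) < h x then v (g • x) + (q - 1) * v x else q * v x := rfl

variable {h : X → ℕ} {q : R} {g : G}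

theorem heckeOp_mul_self (hg : g * g = 1) :
    heckeOp h q g * heckeOp h q g = (q - 1) • heckeOp h q g + q • 1 := by
  ext1 v
  ext x
  have e : g • g • x = x := by rw [smul_smul, hg, one_smul]
  simp only [Module.End.mul_apply, LinearMap.add_apply, LinearMap.smul_apply, Pi.add_apply,
    Pi.smul_apply, smul_eq_mul, Module.End.one_apply, heckeOp_apply, e]
  rcases lt_trichotomy (h x) (h (g • x)) with h1 | h1 | h1
  · simp only [h1, h1.not_gt, if_true, if_false]
    ring
  · simp only [h1, lt_irrefl, if_false]
    ring
  · simp only [h1, h1.not_gt, if_true, if_false]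
    ring

theorem heckeOp_single_of_lt [DecidableEq X] (hg : g * g = 1) {x : X} (hx : h x < h (g • x)) :
    heckeOp h q g (Pi.single x 1) = Pi.single (g • x) 1 := by
  ext z
  have hz : g • g • z = z := by rw [smul_smul, hg, one_smul]
  have hz' : g • z = x ↔ z = g • x := by
    constructor
    · rintro rfl
      exact hz.symm
    · rintro rfl
      rw [smul_smul, hg, one_smul]
  rw [heckeOp_apply]
  by_cases h1 : z = g • x
  · have h2 := hz'.2 h1
    have h3 : z ≠ x := by
      rintro rfl
      rw [← h1] at hx
      exact lt_irrefl _ hx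
    rw [← h1] at hx ⊢
    simp [h2, h3, hx, hx.not_gt]
  · have h2 : g • z ≠ x := fun h2 => h1 (hz'.1 h2)
    by_cases h3 : z = x
    · subst h3
      simp [hx, h1, h2]
    · simp [h1, h2, h3]

theorem heckeOp_single_of_eq [DecidableEq X] {x : X} (hx : g • x = x) :
    heckeOp h q g (Pi.single x 1) = q • Pi.single x 1 := by
  ext z
  rw [heckeOp_apply]
  by_cases h1 : z = x
  · simp [h1, hx]
  · have h2 : g • z ≠ x := fun h2 => h1 (by rw [← hx] at h2; exact smul_left_cancel g h2)
    simp [h1, h2]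

/-- Hecke operators scale the weighted sum of a function by `q`. -/
theorem sum_pow_mul_heckeOp [Fintype X] (hg : g * g = 1)
    (hstep : ∀ x, h (g • x) ≤ h x + 1) (v : X → R) :
    ∑ x, q ^ h x * heckeOp h q g v x = q * ∑ x, q ^ h x * v x := by
  classical
  have e : ∀ x : X, g • g • x = x := fun x => by rw [smul_smul, hg, one_smul]
  rw [Finset.mul_sum, ← sub_eq_zero, ← Finset.sum_sub_distrib]
  refine Finset.sum_involution (fun x _ => g • x) (fun x _ => ?_) (fun x _ hx hgx => hx ?_)
    (fun x _ => Finset.mem_univ _) (fun x _ => e x)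
  · simp only [heckeOp_apply, e]
    have h1 := hstep x
    have h2 := hstep (g • x)
    rw [e] at h2
    rcases lt_trichotomy (h x) (h (g • x)) with h3 | h3 | h3
    · have h4 : h (g • x) = h x + 1 := by lia
      simp only [h3, h3.not_gt, if_true, if_false]
      rw [h4]
      ring
    · simp only [h3, lt_irrefl, if_false]
      ring
    · have h4 : h x = h (g • x) + 1 := by lia
      simp only [h3, h3.not_gt, if_true, if_false]
      rw [h4]
      ring
  · rw [heckeOp_apply]
    simp only [hgx, lt_irrefl, if_false]
    ring

end heckeOp

/-- The Hecke operators of a quasiparabolic set satisfy the braid relations. -/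
theorem IsQuasiparabolic.altProd_heckeOp_comm {cs : CoxeterSystem M W} {X R : Type*}
    [MulAction W X] [CommRing R] [Finite X] {h : X → ℕ}
    (hX : IsQuasiparabolic cs (fun x => (h x : ℤ))) (q : R) (a b : B) {m : ℕ} (hm : 0 < m)
    (hab : (cs.simple b * cs.simple a) ^ m = 1) :
    altProd (heckeOp h q (cs.simple a)) (heckeOp h q (cs.simple b)) m =
      altProd (heckeOp h q (cs.simple b)) (heckeOp h q (cs.simple a)) m := by
  classical
  have hs : ∀ b, cs.simple b * cs.simple b = 1 := cs.simple_mul_simple_self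
  have hquad : ∀ b, heckeOp h q (cs.simple b) * heckeOp h q (cs.simple b) =
      (q - 1) • heckeOp h q (cs.simple b) + q • 1 := fun b => heckeOp_mul_self (hs b)
  have hup : ∀ {a b : B} {y : ℤ → X}, IsAltWalk (cs.simple a) (cs.simple b) y → ∀ k : ℕ,
      (∀ i : ℤ, 0 ≤ i → i ≤ k → (h (y i) : ℤ) = h (y 0) + i) →
      altProd (heckeOp h q (cs.simple a)) (heckeOp h q (cs.simple b)) k
        (Pi.single (y 0) 1) = Pi.single (y k) 1 := by
    intro a b y hy k hk
    refine altProd_apply_seq _ _ (fun i => (Pi.single (y i) 1 : X → R)) k fun i hi => ?_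
    have h1 := hk i (by lia) (by lia)
    have h2 := hk (i + 1) (by lia) (by lia)
    have e := hy i
    have hlt : h (y i) < h (y (i + 1)) := by lia
    push_cast
    rw [e] at hlt ⊢
    by_cases hi : Even i
    · simp only [Int.even_coe_nat, hi, if_true] at hlt ⊢
      exact (heckeOp_single_of_lt (hs a) hlt).symm
    · simp only [Int.even_coe_nat, hi, if_false] at hlt ⊢
      exact (heckeOp_single_of_lt (hs b) hlt).symm
  have hpath : ∀ {a b : B} {y : ℤ → X}, IsAltWalk (cs.simple a) (cs.simple b) y →
      ∀ {k : ℕ}, 0 < k → IsPathClimb y (fun x => (h x : ℤ)) k →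
      altProd (heckeOp h q (cs.simple a)) (heckeOp h q (cs.simple b)) k (Pi.single (y 0) 1) =
        altProd (heckeOp h q (cs.simple b)) (heckeOp h q (cs.simple a)) k (Pi.single (y 0) 1) := by
    rintro a b y hy k hk ⟨e0, ek, hh⟩
    obtain ⟨j, rfl⟩ : ∃ j, k = j + 1 := ⟨k - 1, by lia⟩
    have h1 := hup hy j fun i h1 h2 => hh i h1 (by push_cast; lia)
    have h2 : cs.simple b • y 0 = y 0 := by
      have := hy.sub_one (hs a) (hs b) 0
      simp only [zero_sub, e0, Even.zero, if_true] at this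
      exact this.symm
    have h3 : (if Even j then cs.simple a else cs.simple b) • y j = y j := by
      have := hy j
      push_cast at ek
      rw [add_sub_cancel_right] at ek
      simpa only [ek, Int.even_coe_nat] using this.symm
    rw [altProd_succ', Module.End.mul_apply, h1, altProd, Module.End.mul_apply,
      heckeOp_single_of_eq h2, map_smul, h1]
    split_ifs at h3 ⊢ <;> exact heckeOp_single_of_eq h3
  have key : ∀ n (x : X), h x = n →
      altProd (heckeOp h q (cs.simple a)) (heckeOp h q (cs.simple b)) m (Pi.single x 1) =
        altProd (heckeOp h q (cs.simple b)) (heckeOp h q (cs.simple a)) m (Pi.single x 1) := by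
    intro n
    induction n using Nat.strong_induction_on with
    | _ n ih =>
    intro x hx
    have hdown : ∀ c, h (cs.simple c • x) < h x →
        heckeOp h q (cs.simple c) (Pi.single (cs.simple c • x) 1) = Pi.single x 1 := by
      intro c hc
      have e : cs.simple c • cs.simple c • x = x := by rw [smul_smul, hs, one_smul]
      rw [heckeOp_single_of_lt (hs c) (by rwa [e]), e]
    by_cases ha : h (cs.simple a • x) < h x
    · rw [← hdown a ha]
      exact altProd_comm_apply (hquad a) (hquad b) hm (ih _ (hx ▸ ha) _ rfl)
    by_cases hb : h (cs.simple b • x) < h x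
    · rw [← hdown b hb]
      exact (altProd_comm_apply (hquad b) (hquad a) hm (ih _ (hx ▸ hb) _ rfl).symm).symm
    obtain ⟨y, hy, rfl⟩ := IsAltWalk.exists_walk (cs.simple a) (cs.simple b) x
    have hy' := hy.neg (hs a) (hs b)
    have e1 : y 1 = cs.simple a • y 0 := by simpa using hy 0
    have e2 : y (-1) = cs.simple b • y 0 := by simpa using hy' 0
    obtain ⟨k, hk, hkm, hc⟩ := (hX.isQuasiparabolicWalk hy).exists_climb hm
      (by rw [hy.two_mul, hab, one_smul]) (by rw [e1]; lia) (by rw [e2]; lia)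
    refine altProd_comm_of_dvd (hquad a) (hquad b) hk hkm ?_
    rcases hc with hc | hc | hc
    · rw [hup hy k fun i h1 h2 => (hc.2 i h1 h2).1, hc.1]
      have := hup hy' k fun i h1 h2 => by simpa using (hc.2 i h1 h2).2
      simpa using this.symm
    · exact hpath hy hk hc
    · simpa using (hpath hy' hk hc).symm
  refine LinearMap.pi_ext fun x r => ?_
  have hr : (Pi.single x r : X → R) = r • Pi.single x 1 := by
    rw [← Pi.single_smul, smul_eq_mul, mul_one]
  rw [hr, map_smul, map_smul, key _ x rfl]

/-! ### Products of operators indexed by the group -/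

section matsumoto

variable {R V : Type*} [CommRing R] [AddCommGroup V] [Module R V] {cs : CoxeterSystem M W}
  {T : B → Module.End R V}

theorem IsAltWalk.altProd_apply_of_descent {a b : B} {y : ℤ → W}
    (hy : IsAltWalk (cs.simple a) (cs.simple b) y) {f : W → V} {n : ℕ}
    (hn : cs.length (y 0) = n + 1)
    (hf : ∀ v c, cs.length v ≤ n → cs.length (cs.simple c * v) < cs.length v →
      f v = T c (f (cs.simple c * v))) (k : ℕ)
    (hk : ∀ i : ℤ, 0 ≤ i → i ≤ k + 1 → (cs.length (y i) : ℤ) = cs.length (y 0) - i) :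
    altProd (if Even k then T a else T b) (if Even k then T b else T a) (k + 1)
      (f (y (k + 1))) = T a (f (y 1)) := by
  induction k with
  | zero => simp [altProd]
  | succ k ih =>
    rw [← ih fun i h1 h2 => hk i h1 (by push_cast; lia), altProd_succ, Module.End.mul_apply]
    have h1 := hk (k + 1) (by lia) (by lia)
    have h2 := hk (k + 1 + 1) (by lia) (by push_cast; lia)
    have e := hy (k + 1)
    rw [smul_eq_mul] at e
    push_cast
    by_cases h : Even k
    · simp only [h, Nat.even_add_one, Int.even_add_one, Int.even_coe_nat, not_true, if_true,
        if_false] at e ⊢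
      rw [e, ← hf _ b (by lia) (by rw [← e]; lia)]
    · simp only [h, Nat.even_add_one, Int.even_add_one, Int.even_coe_nat, not_false_iff, if_true,
        if_false] at e ⊢
      rw [e, ← hf _ a (by lia) (by rw [← e]; lia)]

/-- The sum of all basis elements of a Hecke module is fixed, up to scaling, by the generators. -/
theorem CoxeterSystem.apply_sum_of_descent [Fintype W] {q : R} {b : B}
    (hq : T b * T b = (q - 1) • T b + q • 1) {f : W → V}
    (hf : ∀ w, cs.length (cs.simple b * w) < cs.length w → f w = T b (f (cs.simple b * w))) :
    T b (∑ w, f w) = q • ∑ w, f w := by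
  have hpair : ∀ w, cs.length (cs.simple b * w) < cs.length w →
      T b (f w) + T b (f (cs.simple b * w)) = q • f w + q • f (cs.simple b * w) := by
    intro w hw
    have := LinearMap.congr_fun hq (f (cs.simple b * w))
    simp only [Module.End.mul_apply, LinearMap.add_apply, LinearMap.smul_apply,
      Module.End.one_apply, ← hf w hw] at this
    rw [this, ← hf w hw, sub_smul, one_smul]
    abel
  rw [map_sum, Finset.smul_sum, ← sub_eq_zero, ← Finset.sum_sub_distrib]
  refine Finset.sum_involution (fun w _ => cs.simple b * w) (fun w _ => ?_)
    (fun w _ _ h => cs.length_simple_mul_ne w b (congrArg cs.length h))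
    (fun w _ => Finset.mem_univ _) (fun w _ => cs.simple_mul_simple_cancel_left b)
  rcases lt_or_gt_of_ne (cs.length_simple_mul_ne w b) with h | h
  · rw [sub_add_sub_comm, hpair w h, sub_self]
  · have := hpair (cs.simple b * w) (by rwa [cs.simple_mul_simple_cancel_left b])
    rw [cs.simple_mul_simple_cancel_left b] at this
    rw [sub_add_sub_comm, add_comm, this, add_comm, sub_self]

variable [Finite W]

theorem CoxeterSystem.apply_descent_eq_apply_descent
    (hT : ∀ a b m, 0 < m → (cs.simple b * cs.simple a) ^ m = 1 →
      altProd (T a) (T b) m = altProd (T b) (T a) m) {f : W → V} {n : ℕ}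
    (hf : ∀ v c, cs.length v ≤ n → cs.length (cs.simple c * v) < cs.length v →
      f v = T c (f (cs.simple c * v))) {w : W} (hw : cs.length w = n + 1) {a b : B}
    (ha : cs.length (cs.simple a * w) < cs.length w)
    (hb : cs.length (cs.simple b * w) < cs.length w) :
    T a (f (cs.simple a * w)) = T b (f (cs.simple b * w)) := by
  have hs : ∀ b, cs.simple b * cs.simple b = 1 := cs.simple_mul_simple_self
  obtain ⟨y, hy, rfl⟩ := IsAltWalk.exists_walk (cs.simple a) (cs.simple b) w
  have hy' := hy.neg (hs a) (hs b)
  have e1 : y 1 = cs.simple a * y 0 := by simpa using hy 0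
  have e2 : y (-1) = cs.simple b * y 0 := by simpa using hy' 0
  have hne : ∀ i, y (i + 1) ≠ y i := by
    intro i hi
    have := hy i
    rw [hi, smul_eq_mul] at this
    split_ifs at this
    · exact cs.length_simple_mul_ne _ _ (congrArg cs.length this.symm)
    · exact cs.length_simple_mul_ne _ _ (congrArg cs.length this.symm)
  have hwalk := (cs.isQuasiparabolic_length.isQuasiparabolicWalk hy).neg_height
  obtain ⟨k, hk, -, hc⟩ := hwalk.exists_climb (orderOf_pos (cs.simple b * cs.simple a))
    (by rw [hy.two_mul, pow_orderOf_eq_one, one_smul]) (by rw [e1]; lia) (by rw [e2]; lia)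
  rcases hc with hc | hc | hc
  · obtain ⟨k, rfl⟩ : ∃ j, k = j + 1 := ⟨k - 1, by lia⟩
    have h1 := hy.altProd_apply_of_descent (T := T) hw hf k fun i h1 h2 => by
      have := (hc.2 i h1 (by push_cast; lia)).1
      lia
    have h2 := hy'.altProd_apply_of_descent (T := T) (by simpa using hw) hf k fun i h1 h2 => by
      have := (hc.2 i h1 (by push_cast; lia)).2
      simp only [neg_zero]
      lia
    have hend := hc.1
    push_cast at hend
    rw [← hend] at h2
    rw [← e1, ← e2, ← h1, ← h2]
    have hper : (cs.simple b * cs.simple a) ^ (k + 1) = 1 := by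
      have h3 := hy.eq_translate (hs a) (hs b) (by rw [sub_neg_eq_add]; exact ⟨_, rfl⟩) hend (k + 1)
      have h4 := hy.two_mul (k + 1)
      push_cast at h4
      rw [_root_.two_mul, h3, neg_add_cancel, smul_eq_mul] at h4
      exact mul_eq_right.1 h4.symm
    have := hT a b (k + 1) (by lia) hper
    split_ifs
    · rw [this]
    · rw [this]
  · exact absurd hc.1.symm (by simpa using hne (-1))
  · exact absurd hc.1 (by simpa using hne 0)

theorem CoxeterSystem.exists_forall_descent
    (hT : ∀ a b m, 0 < m → (cs.simple b * cs.simple a) ^ m = 1 →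
      altProd (T a) (T b) m = altProd (T b) (T a) m) (v₀ : V) :
    ∃ f : W → V, f 1 = v₀ ∧ ∀ w b, cs.length (cs.simple b * w) < cs.length w →
      f w = T b (f (cs.simple b * w)) := by
  classical
  have key : ∀ n, ∃ f : W → V, f 1 = v₀ ∧ ∀ w b, cs.length w ≤ n →
      cs.length (cs.simple b * w) < cs.length w → f w = T b (f (cs.simple b * w)) := by
    intro n
    induction n with
    | zero => exact ⟨fun _ => v₀, rfl, fun w b h1 h2 => by lia⟩
    | succ n ih =>
      obtain ⟨f, hf1, hf⟩ := ih
      have hd : ∀ w, ∃ v, cs.length w = n + 1 → ∀ b,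
          cs.length (cs.simple b * w) < cs.length w → v = T b (f (cs.simple b * w)) := by
        intro w
        by_cases hw : cs.length w = n + 1
        · obtain ⟨a, ha⟩ := cs.exists_leftDescent_of_ne_one (w := w) (by
            rintro rfl
            simp at hw)
          exact ⟨_, fun _ b hb => cs.apply_descent_eq_apply_descent hT hf hw ha hb⟩
        · exact ⟨0, fun h => absurd h hw⟩
      choose g hg using hd
      refine ⟨fun w => if cs.length w = n + 1 then g w else f w, by simpa using hf1,
        fun w b h1 h2 => ?_⟩
      have h3 : cs.length (cs.simple b * w) ≠ n + 1 := by lia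
      by_cases hw : cs.length w = n + 1
      · simpa [hw, h3] using hg w hw b h2
      · simpa [hw, h3] using hf w b (by lia) h2
  obtain ⟨n, hn⟩ := (Set.finite_range cs.length).bddAbove
  obtain ⟨f, hf1, hf⟩ := key n
  exact ⟨f, hf1, fun w b h => hf w b (hn ⟨w, rfl⟩) h⟩

end matsumoto

/-- An eigenfunction of a Hecke operator is invariant. -/
theorem apply_smul_of_heckeOp_eq_smul {G X R : Type*} [Group G] [MulAction G X] [CommRing R]
    [IsDomain R] {h : X → ℕ} {q : R} (hq : q ≠ 0) {g : G} {e : X → R}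
    (he : heckeOp h q g e = q • e) {x : X} (hx : h (g • x) = h x → g • x = x) :
    e (g • x) = e x := by
  have h1 := congrFun he x
  rw [heckeOp_apply, Pi.smul_apply, smul_eq_mul] at h1
  split_ifs at h1 with h2 h3
  · exact mul_left_cancel₀ hq h1
  · linear_combination h1
  · rw [hx (by lia)]

theorem cosetHeightN_one (cs : CoxeterSystem M W) (H : Subgroup W) :
    cosetHeightN cs H (1 : W) = 0 :=
  Nat.sInf_eq_zero.2 (Or.inl ⟨1, rfl, cs.length_one⟩)

/-- for a finite Coxeter group `W` and a quasiparabolic subgroup `H`,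
the Poincaré polynomial of `W ⧸ H` divides the Poincaré polynomial of `W` in `ℤ[q]`. -/
theorem poincare_divides (cs : CoxeterSystem M W) [Finite W] (H : Subgroup W)
    (hqp : IsQuasiparabolicSubgroup cs H) :
    (∑ᶠ x : W ⧸ H, (Polynomial.X : Polynomial ℤ) ^ cosetHeightN cs H x) ∣
      ∑ᶠ w : W, (Polynomial.X : Polynomial ℤ) ^ cs.length w := by
  classical
  have := Fintype.ofFinite W
  have := Fintype.ofFinite (W ⧸ H)
  rw [finsum_eq_sum_of_fintype, finsum_eq_sum_of_fintype]
  set h := cosetHeightN cs H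
  set q : Polynomial ℤ := Polynomial.X
  have hX : IsQuasiparabolic cs (fun x => (h x : ℤ)) := hqp
  have hs : ∀ b, cs.simple b * cs.simple b = 1 := cs.simple_mul_simple_self
  obtain ⟨f, hf1, hf⟩ := cs.exists_forall_descent (T := fun b => heckeOp h q (cs.simple b))
    (fun a b _ hm hab => hX.altProd_heckeOp_comm q a b hm hab) (Pi.single ((1 : W) : W ⧸ H) 1)
  have hinv : ∀ b x, (∑ w, f w) (cs.simple b • x) = (∑ w, f w) x := fun b x =>
    apply_smul_of_heckeOp_eq_smul Polynomial.X_ne_zero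
      (cs.apply_sum_of_descent (T := fun b => heckeOp h q (cs.simple b))
        (heckeOp_mul_self (hs b)) fun w hw => hf w b hw)
      fun hx => hX.2.1 _ x (cs.isReflection_simple b) (congrArg Nat.cast hx)
  have hconst : ∀ x, (∑ w, f w) x = (∑ w, f w) (1 : W) := by
    intro x
    induction x using QuotientGroup.induction_on with
    | H w =>
      induction w using cs.simple_induction_left with
      | one => rfl
      | mul_simple_left w b ih => exact (hinv b w).trans ih
  have hstep : ∀ b x, h (cs.simple b • x) ≤ h x + 1 := by
    intro b x
    have := (abs_le.1 (hX.1 b x)).2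
    lia
  have hweight : ∀ n w, cs.length w = n → ∑ x, q ^ h x * f w x = q ^ n := by
    intro n
    induction n with
    | zero =>
      intro w hw
      rw [cs.length_eq_zero_iff.1 hw, hf1, Finset.sum_eq_single ((1 : W) : W ⧸ H)]
      · simp [h, cosetHeightN_one]
      · intro x _ hx
        simp [hx]
      · simp
    | succ n ih =>
      intro w hw
      obtain ⟨b, hb⟩ := cs.exists_leftDescent_of_ne_one (w := w) (by
        rintro rfl
        simp at hw)
      have hb' := cs.isLeftDescent_iff.1 hb
      rw [hf w b hb, sum_pow_mul_heckeOp (hs b) (hstep b), ih _ (by lia), pow_succ']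
  refine ⟨(∑ w, f w) (1 : W), ?_⟩
  calc ∑ w, q ^ cs.length w = ∑ w, ∑ x, q ^ h x * f w x :=
        Finset.sum_congr rfl fun w _ => (hweight _ w rfl).symm
    _ = ∑ x, q ^ h x * (∑ w, f w) x := by
        rw [Finset.sum_comm]
        simp only [Finset.sum_apply, Finset.mul_sum]
    _ = _ := by simp only [hconst, Finset.sum_mul]
end
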